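/- Let Ω ⊂ ℝ⁴ be a connected open set, λ > 0, and let v ∈ C⁴(Ω) be a convex solution of equation (★). Then the rank of the Hessian ∇²v(x) is the same for all x ∈ Ω (constant rank theorem). -/

import Mathlib

/-- First-order real partial derivative `∂f/∂xᵢ` on `ℝ⁴ ≅ ℂ²`. -/
noncomputable def pd (f : (Fin 4 → ℝ) → ℝ) (i : Fin 4) (x : Fin 4 → ℝ) : ℝ :=
  fderiv ℝ f x (Pi.single i 1)

/-- Second-order real partial derivative `∂²f/∂xᵢ∂xⱼ`. -/
noncomputable def pd2 (f : (Fin 4 → ℝ) → ℝ) (i j : Fin 4) (x : Fin 4 → ℝ) : ℝ :=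
  pd (fun y => pd f i y) j x

/-- The real Hessian matrix of `f` at `x`. -/
noncomputable def hessM (f : (Fin 4 → ℝ) → ℝ) (x : Fin 4 → ℝ) :
    Matrix (Fin 4) (Fin 4) ℝ :=
  Matrix.of fun i j => pd2 f i j x

/-- Equation (★) (indices 1,2,3,4 are `0,1,2,3`). -/
def StarEq (lam : ℝ) (v : (Fin 4 → ℝ) → ℝ) (Ω : Set (Fin 4 → ℝ)) : Prop :=
  ∀ x ∈ Ω,
    (pd2 v 0 0 x + pd2 v 2 2 x) * (pd2 v 1 1 x + pd2 v 3 3 x)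
      - (pd2 v 0 1 x + pd2 v 2 3 x)^2 - (pd2 v 0 3 x - pd2 v 1 2 x)^2
      - ((pd v 0 x)^2 + (pd v 2 x)^2) * (pd2 v 1 1 x + pd2 v 3 3 x)
      - ((pd v 1 x)^2 + (pd v 3 x)^2) * (pd2 v 0 0 x + pd2 v 2 2 x)
      + 2 * (pd v 0 x * pd v 1 x + pd v 2 x * pd v 3 x) * (pd2 v 0 1 x + pd2 v 2 3 x)
      + 2 * (pd v 0 x * pd v 3 x - pd v 1 x * pd v 2 x) * (pd2 v 0 3 x - pd2 v 1 2 x)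
      = lam

open Filter Topology Set

theorem second_order_min {φ ψ : ℝ → ℝ} {c : ℝ} (h0 : φ 0 = 0)
    (hφ : ∀ᶠ t in 𝓝 (0 : ℝ), 0 ≤ φ t) (hd : ∀ᶠ t in 𝓝 (0 : ℝ), HasDerivAt φ (ψ t) t)
    (hψ : HasDerivAt ψ c 0) : ψ 0 = 0 ∧ 0 ≤ c := by
  have hmin : IsLocalMin φ 0 := by
    filter_upwards [hφ] with t ht
    rwa [h0]
  have hψ0 : ψ 0 = 0 := hmin.hasDerivAt_eq_zero hd.self_of_nhds
  refine ⟨hψ0, ?_⟩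
  by_contra! hc
  have hde : deriv φ =ᶠ[𝓝 0] ψ := by
    filter_upwards [hd] with t ht using ht.deriv
  have hdd : deriv (deriv φ) 0 = c := by rw [hde.deriv_eq, hψ.deriv]
  have hmax : IsLocalMax φ 0 := isLocalMax_of_deriv_deriv_neg (by rwa [hdd])
    (by rw [hde.self_of_nhds, hψ0]) hd.self_of_nhds.continuousAt
  have hz : φ =ᶠ[𝓝 0] fun _ => (0 : ℝ) := by
    filter_upwards [hmax, hφ] with t h1 h2
    rw [h0] at h1
    exact le_antisymm h1 h2
  have : deriv (deriv φ) 0 = 0 := by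
    have h1 : deriv φ =ᶠ[𝓝 0] deriv fun _ : ℝ => (0 : ℝ) := hz.deriv
    rw [h1.deriv_eq]; simp
  linarith

section Derivatives

variable {E : Type*} [NormedAddCommGroup E] [NormedSpace ℝ E] {v : E → ℝ} {x : E}

/-- The second derivative as a bilinear form. -/
noncomputable def d2 (v : E → ℝ) (x : E) : E →L[ℝ] E →L[ℝ] ℝ := fderiv ℝ (fderiv ℝ v) x

/-- The third derivative, with its first argument fixed, as a bilinear form. -/
noncomputable def d3 (v : E → ℝ) (x a : E) : E →L[ℝ] E →L[ℝ] ℝ := fderiv ℝ (d2 v) x a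

/-- The fourth derivative, with its first two arguments fixed, as a bilinear form. -/
noncomputable def d4 (v : E → ℝ) (x a b : E) : E →L[ℝ] E →L[ℝ] ℝ :=
  fderiv ℝ (fun y => d3 v y b) x a

theorem hasFDerivAt_fderiv_apply {F : Type*} [NormedAddCommGroup F] [NormedSpace ℝ F] {g : E → F}
    (hg : ContDiffAt ℝ 2 g x) (a : E) :
    HasFDerivAt (fun y => fderiv ℝ g y a) ((fderiv ℝ (fderiv ℝ g) x).flip a) x := by
  have h : DifferentiableAt ℝ (fderiv ℝ g) x :=
    (hg.fderiv_right (m := 1) (by norm_num)).differentiableAt (by norm_num)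
  simpa using h.hasFDerivAt.clm_apply (hasFDerivAt_const a x)

theorem fderiv_fderiv_apply_comm {F : Type*} [NormedAddCommGroup F] [NormedSpace ℝ F] {g : E → F}
    (hg : ContDiffAt ℝ 2 g x) (a b : E) :
    fderiv ℝ (fun y => fderiv ℝ g y b) x a = fderiv ℝ (fun y => fderiv ℝ g y a) x b := by
  rw [(hasFDerivAt_fderiv_apply hg a).fderiv, (hasFDerivAt_fderiv_apply hg b).fderiv]
  exact hg.isSymmSndFDerivAt (by simp) a b

theorem contDiffAt_fderiv (hv : ContDiffAt ℝ 4 v x) : ContDiffAt ℝ 3 (fderiv ℝ v) x :=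
  hv.fderiv_right (by norm_num)

theorem contDiffAt_d2 (hv : ContDiffAt ℝ 4 v x) : ContDiffAt ℝ 2 (d2 v) x :=
  (contDiffAt_fderiv hv).fderiv_right (by norm_num)

theorem d2_symm (hv : ContDiffAt ℝ 4 v x) (a b : E) : d2 v x a b = d2 v x b a :=
  hv.isSymmSndFDerivAt (by simp; norm_num) a b

theorem d3_symm_left (hv : ContDiffAt ℝ 4 v x) (a b c : E) :
    d3 v x a b c = d3 v x b a c :=
  congrArg (fun L => L c) ((contDiffAt_fderiv hv).isSymmSndFDerivAt (by simp; norm_num) a b)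

theorem d4_symm_left (hv : ContDiffAt ℝ 4 v x) (a b c e : E) :
    d4 v x a b c e = d4 v x b a c e :=
  congrArg (fun L => L c e) (fderiv_fderiv_apply_comm (contDiffAt_d2 hv) a b)

theorem eventually_contDiffAt (hv : ContDiffAt ℝ 4 v x) : ∀ᶠ y in 𝓝 x, ContDiffAt ℝ 4 v y :=
  hv.eventually (by norm_num)

theorem hasDerivAt_line {F : Type*} [NormedAddCommGroup F] [NormedSpace ℝ F]
    {f : E → F} {f' : E →L[ℝ] F} {ξ : E} {t : ℝ}
    (hf : HasFDerivAt f f' (x + t • ξ)) : HasDerivAt (fun s => f (x + s • ξ)) (f' ξ) t := by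
  have hl : HasDerivAt (fun s : ℝ => x + s • ξ) ξ t := by
    simpa using ((hasDerivAt_id t).smul_const ξ).const_add x
  exact hf.comp_hasDerivAt t hl

theorem hasDerivAt_fderiv_line {ξ : E} {t : ℝ} (hv : ContDiffAt ℝ 4 v (x + t • ξ))
    (a : E) : HasDerivAt (fun s => fderiv ℝ v (x + s • ξ) a) (d2 v (x + t • ξ) ξ a) t := by
  simpa [d2] using (hasDerivAt_line ((contDiffAt_fderiv hv).differentiableAt
    (by norm_num)).hasFDerivAt).clm_apply (hasDerivAt_const t a)

theorem hasDerivAt_d2_line {ξ : E} {t : ℝ} (hv : ContDiffAt ℝ 4 v (x + t • ξ)) (a b : E) :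
    HasDerivAt (fun s => d2 v (x + s • ξ) a b) (d3 v (x + t • ξ) ξ a b) t := by
  simpa [d3] using ((hasDerivAt_line ((contDiffAt_d2 hv).differentiableAt
    (by norm_num)).hasFDerivAt).clm_apply (hasDerivAt_const t a)).clm_apply
    (hasDerivAt_const t b)

theorem hasDerivAt_d3_line {ξ : E} {t : ℝ} (hv : ContDiffAt ℝ 4 v (x + t • ξ)) (a b c : E) :
    HasDerivAt (fun s => d3 v (x + s • ξ) a b c) (d4 v (x + t • ξ) ξ a b c) t := by
  simpa [d4, d3] using ((hasDerivAt_line (hasFDerivAt_fderiv_apply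
    (contDiffAt_d2 hv) a).differentiableAt.hasFDerivAt).clm_apply
    (hasDerivAt_const t b)).clm_apply (hasDerivAt_const t c)

theorem tendsto_line (x ξ : E) : Tendsto (fun t : ℝ => x + t • ξ) (𝓝 0) (𝓝 x) := by
  have : Continuous fun t : ℝ => x + t • ξ := by fun_prop
  simpa using this.tendsto 0

theorem eventually_line_contDiffAt (hv : ContDiffAt ℝ 4 v x) (ξ : E) :
    ∀ᶠ t : ℝ in 𝓝 0, ContDiffAt ℝ 4 v (x + t • ξ) :=
  (tendsto_line x ξ).eventually (eventually_contDiffAt hv)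

theorem d3_symm_right (hv : ContDiffAt ℝ 4 v x) (a b c : E) :
    d3 v x a b c = d3 v x a c b := by
  have hv0 : ContDiffAt ℝ 4 v (x + (0 : ℝ) • a) := by simpa using hv
  have h3 : (fun s : ℝ => d2 v (x + s • a) b c) =ᶠ[𝓝 0] fun s => d2 v (x + s • a) c b := by
    filter_upwards [eventually_line_contDiffAt hv a] with y hy using d2_symm hy b c
  simpa using (hasDerivAt_d2_line hv0 b c).unique
    ((hasDerivAt_d2_line hv0 c b).congr_of_eventuallyEq h3)

theorem d4_congr_of_d3 (hv : ContDiffAt ℝ 4 v x) (e : E) {a b c a' b' c' : E}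
    (h : ∀ y, ContDiffAt ℝ 4 v y → d3 v y a b c = d3 v y a' b' c') :
    d4 v x e a b c = d4 v x e a' b' c' := by
  have hv0 : ContDiffAt ℝ 4 v (x + (0 : ℝ) • e) := by simpa using hv
  have h3 : (fun s : ℝ => d3 v (x + s • e) a b c) =ᶠ[𝓝 0] fun s => d3 v (x + s • e) a' b' c' := by
    filter_upwards [eventually_line_contDiffAt hv e] with y hy using h _ hy
  simpa using (hasDerivAt_d3_line hv0 a b c).unique
    ((hasDerivAt_d3_line hv0 a' b' c').congr_of_eventuallyEq h3)

theorem d4_symm_right (hv : ContDiffAt ℝ 4 v x) (a b c e : E) :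
    d4 v x a b c e = d4 v x a b e c :=
  d4_congr_of_d3 hv a fun _ hy => d3_symm_right hy b c e

theorem d4_swap (hv : ContDiffAt ℝ 4 v x) (a b : E) : d4 v x a a b b = d4 v x b b a a :=
  calc d4 v x a a b b = d4 v x a b a b := d4_congr_of_d3 hv a fun _ hy => d3_symm_left hy a b b
    _ = d4 v x b a a b := d4_symm_left hv a b a b
    _ = d4 v x b a b a := d4_symm_right hv b a a b
    _ = d4 v x b b a a := d4_congr_of_d3 hv b fun _ hy => d3_symm_left hy a b a

end Derivatives

theorem d2_nonneg_of_convexOn {E : Type*} [NormedAddCommGroup E] [NormedSpace ℝ E] {v : E → ℝ}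
    {Ω : Set E} (hΩ : IsOpen Ω) (hconv : ConvexOn ℝ Ω v) {x : E} (hx : x ∈ Ω)
    (hv : ContDiffAt ℝ 4 v x) (w : E) : 0 ≤ d2 v x w w := by
  have hv' : ∀ᶠ y in 𝓝 x, DifferentiableAt ℝ v y := by
    filter_upwards [eventually_contDiffAt hv] with y hy using hy.differentiableAt (by norm_num)
  have hv0 : ∀ ξ : E, ContDiffAt ℝ 4 v (x + (0 : ℝ) • ξ) := by simpa using hv
  have key := second_order_min (φ := fun t => v (x + t • w) + v (x + t • -w) - 2 * v x)
    (ψ := fun t => fderiv ℝ v (x + t • w) w + fderiv ℝ v (x + t • -w) (-w) - 0)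
    (c := d2 v (x + (0 : ℝ) • w) w w + d2 v (x + (0 : ℝ) • -w) (-w) (-w))
    (by simp; ring) ?_ ?_ ?_
  · simpa using key.2
  · filter_upwards [(tendsto_line x w).eventually (hΩ.mem_nhds hx),
      (tendsto_line x (-w)).eventually (hΩ.mem_nhds hx)] with t h1 h2
    have := hconv.2 h1 h2 (show (0 : ℝ) ≤ 1 / 2 by norm_num) (show (0 : ℝ) ≤ 1 / 2 by norm_num)
      (by norm_num)
    have hmid : (1 / 2 : ℝ) • (x + t • w) + (1 / 2 : ℝ) • (x + t • -w) = x := by module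
    rw [hmid] at this
    simp only [smul_eq_mul] at this
    linarith
  · filter_upwards [(tendsto_line x w).eventually hv', (tendsto_line x (-w)).eventually hv']
      with t h1 h2
    exact ((hasDerivAt_line h1.hasFDerivAt).add (hasDerivAt_line h2.hasFDerivAt)).sub
      (hasDerivAt_const t _)
  · exact ((hasDerivAt_fderiv_line (hv0 w) w).add (hasDerivAt_fderiv_line (hv0 (-w)) (-w))).sub_const 0

/-- First and second order conditions at a minimum, along a line, of the quadratic form
`w ↦ (D²v(n, n) - h) |w|² + D²v(w, w)` evaluated on a linearly varying vector `w`. -/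
theorem rayleigh_second_order {v h : (Fin 4 → ℝ) → ℝ} {x : Fin 4 → ℝ} (hv : ContDiffAt ℝ 4 v x)
    (hh : ContDiffAt ℝ 4 h x) {n e y ξ : Fin 4 → ℝ}
    (h0 : (d2 v x n n - h x) * (e ⬝ᵥ e) + d2 v x e e = 0)
    (hmin : ∀ᶠ t : ℝ in 𝓝 0, 0 ≤ (d2 v (x + t • ξ) n n - h (x + t • ξ)) *
      ((e + t • y) ⬝ᵥ (e + t • y)) + d2 v (x + t • ξ) (e + t • y) (e + t • y)) :
    d3 v x ξ e e + 2 * d2 v x e y + (d3 v x ξ n n - fderiv ℝ h x ξ) * (e ⬝ᵥ e)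
      + 2 * (d2 v x n n - h x) * (e ⬝ᵥ y) = 0 ∧
    0 ≤ d4 v x ξ ξ e e + 4 * d3 v x ξ e y + 2 * d2 v x y y
      + (d4 v x ξ ξ n n - d2 h x ξ ξ) * (e ⬝ᵥ e)
      + 4 * (d3 v x ξ n n - fderiv ℝ h x ξ) * (e ⬝ᵥ y) + 2 * (d2 v x n n - h x) * (y ⬝ᵥ y) := by
  have hv' := eventually_line_contDiffAt hv ξ
  have hh' := eventually_line_contDiffAt hh ξ
  have h2t : ∀ t : ℝ, HasDerivAt (fun t : ℝ => 2 * t) 2 t := by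
    intro t; simpa using (hasDerivAt_id t).const_mul 2
  have ht2 : ∀ t : ℝ, HasDerivAt (fun t : ℝ => t ^ 2) (2 * t) t := by
    intro t; simpa using hasDerivAt_pow 2 t
  have hsq : ∀ t : ℝ, HasDerivAt (fun t : ℝ => e ⬝ᵥ e + 2 * t * (e ⬝ᵥ y) + t ^ 2 * (y ⬝ᵥ y))
      (2 * (e ⬝ᵥ y) + 2 * t * (y ⬝ᵥ y)) t := fun t =>
    (((h2t t).mul_const (e ⬝ᵥ y)).const_add (e ⬝ᵥ e)).add ((ht2 t).mul_const (y ⬝ᵥ y))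
  have hlin : ∀ t : ℝ, HasDerivAt (fun t : ℝ => 2 * (e ⬝ᵥ y) + 2 * t * (y ⬝ᵥ y))
      (2 * (y ⬝ᵥ y)) t := fun t => ((h2t t).mul_const (y ⬝ᵥ y)).const_add _
  have hvt := hv'.self_of_nhds
  have hht := hh'.self_of_nhds
  have hψ := ((((hasDerivAt_d3_line hvt ξ n n).sub (hasDerivAt_fderiv_line hht ξ)).mul
      (hsq 0)).add (((hasDerivAt_d2_line hvt n n).sub (hasDerivAt_line
        (hht.differentiableAt (by norm_num)).hasFDerivAt)).mul (hlin 0))).add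
      (((hasDerivAt_d3_line hvt ξ e e).add (((hasDerivAt_d2_line hvt e y).const_mul 2).add
        ((h2t 0).mul (hasDerivAt_d3_line hvt ξ e y)))).add
        (((h2t 0).mul (hasDerivAt_d2_line hvt y y)).add
          ((ht2 0).mul (hasDerivAt_d3_line hvt ξ y y))))
  have key := second_order_min
    (φ := fun t => (d2 v (x + t • ξ) n n - h (x + t • ξ)) *
      (e ⬝ᵥ e + 2 * t * (e ⬝ᵥ y) + t ^ 2 * (y ⬝ᵥ y)) + (d2 v (x + t • ξ) e e
        + 2 * t * d2 v (x + t • ξ) e y + t ^ 2 * d2 v (x + t • ξ) y y))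
    (ψ := fun t => (d3 v (x + t • ξ) ξ n n - fderiv ℝ h (x + t • ξ) ξ) *
        (e ⬝ᵥ e + 2 * t * (e ⬝ᵥ y) + t ^ 2 * (y ⬝ᵥ y)) +
        (d2 v (x + t • ξ) n n - h (x + t • ξ)) * (2 * (e ⬝ᵥ y) + 2 * t * (y ⬝ᵥ y))
      + (d3 v (x + t • ξ) ξ e e
        + (2 * d2 v (x + t • ξ) e y + 2 * t * d3 v (x + t • ξ) ξ e y)
        + (2 * t * d2 v (x + t • ξ) y y + t ^ 2 * d3 v (x + t • ξ) ξ y y)))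
    (by simp [h0]) ?_ ?_ hψ
  rotate_left
  · filter_upwards [hmin, hv'] with t ht hvt
    have e1 : (e + t • y) ⬝ᵥ (e + t • y) = e ⬝ᵥ e + 2 * t * (e ⬝ᵥ y) + t ^ 2 * (y ⬝ᵥ y) := by
      simp only [dotProduct, Fin.sum_univ_four, Pi.add_apply, Pi.smul_apply, smul_eq_mul]
      ring
    have e2 : d2 v (x + t • ξ) (e + t • y) (e + t • y) = d2 v (x + t • ξ) e e
        + 2 * t * d2 v (x + t • ξ) e y + t ^ 2 * d2 v (x + t • ξ) y y := by
      simp only [map_add, map_smul, add_apply, smul_apply,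
        smul_eq_mul, d2_symm hvt y e]
      ring
    rw [e1, e2] at ht
    exact ht
  · filter_upwards [hv', hh'] with t hvt hht
    have hd := (hasDerivAt_line (hht.differentiableAt (by norm_num)).hasFDerivAt)
    exact (((hasDerivAt_d2_line hvt n n).sub hd).mul (hsq t)).add
      (((hasDerivAt_d2_line hvt e e).add ((h2t t).mul (hasDerivAt_d2_line hvt e y))).add
        ((ht2 t).mul (hasDerivAt_d2_line hvt y y)))
  · simp only [zero_smul, add_zero, Pi.sub_apply] at key
    refine ⟨?_, ?_⟩
    · linear_combination key.1
    · linear_combination key.2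

section HermitianForms

/-- The complex structure of `ℂ² ≅ ℝ⁴`. -/
def cplx (y : Fin 4 → ℝ) : Fin 4 → ℝ := ![-y 2, -y 3, y 0, y 1]

/-- The Hermitian part `(a, d, b, c)`, standing for the matrix `[[a, b + ic], [b - ic, d]]`,
of a real bilinear form on `ℝ⁴ ≅ ℂ²`. -/
noncomputable def hermPart (S : (Fin 4 → ℝ) →L[ℝ] (Fin 4 → ℝ) →L[ℝ] ℝ) : Fin 4 → ℝ :=
  ![S (Pi.single 0 1) (Pi.single 0 1) + S (Pi.single 2 1) (Pi.single 2 1),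
    S (Pi.single 1 1) (Pi.single 1 1) + S (Pi.single 3 1) (Pi.single 3 1),
    S (Pi.single 0 1) (Pi.single 1 1) + S (Pi.single 2 1) (Pi.single 3 1),
    S (Pi.single 0 1) (Pi.single 3 1) - S (Pi.single 1 1) (Pi.single 2 1)]

/-- The Hermitian matrix `(p q* + q p*) / 2`. -/
noncomputable def rankOne (p q : Fin 4 → ℝ) : Fin 4 → ℝ :=
  ![p 0 * q 0 + p 2 * q 2, p 1 * q 1 + p 3 * q 3,
    (p 0 * q 1 + q 0 * p 1 + p 2 * q 3 + q 2 * p 3) / 2,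
    (p 0 * q 3 + q 0 * p 3 - p 1 * q 2 - q 1 * p 2) / 2]

/-- The determinant of a Hermitian matrix. -/
def hermDet (m : Fin 4 → ℝ) : ℝ := m 0 * m 1 - m 2 ^ 2 - m 3 ^ 2

/-- The polar form of the determinant. -/
def hermPolar (m l : Fin 4 → ℝ) : ℝ := m 0 * l 1 + m 1 * l 0 - 2 * m 2 * l 2 - 2 * m 3 * l 3

/-- The action of a Hermitian matrix on a vector. -/
def hermVec (m y : Fin 4 → ℝ) : Fin 4 → ℝ :=
  ![m 0 * y 0 + m 2 * y 1 + m 3 * y 3, m 2 * y 0 + m 1 * y 1 - m 3 * y 2,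
    -m 3 * y 1 + m 0 * y 2 + m 2 * y 3, m 3 * y 0 + m 2 * y 2 + m 1 * y 3]

/-- The cofactor matrix of a Hermitian matrix. -/
def hermCof (m : Fin 4 → ℝ) : Fin 4 → ℝ := ![m 1, m 0, -m 2, -m 3]

/-- A vector which, together with the first basis vector, diagonalizes the cofactor matrix. -/
def cofDir (m : Fin 4 → ℝ) : Fin 4 → ℝ := ![-m 2, m 0, m 3, 0]

/-- The critical vector for the second variation along `f`. -/
def varVec (k : ℝ) (a m f : Fin 4 → ℝ) : Fin 4 → ℝ := -k • hermVec (hermCof a) (hermVec m f)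

theorem bilin_expand (S : (Fin 4 → ℝ) →L[ℝ] (Fin 4 → ℝ) →L[ℝ] ℝ) (y z : Fin 4 → ℝ) :
    S y z = ∑ i, ∑ j, y i * z j * S (Pi.single i 1) (Pi.single j 1) := by
  have hy : ∀ u : Fin 4 → ℝ, u = ∑ i, u i • Pi.single i (1 : ℝ) := fun u => by
    rw [pi_eq_sum_univ' u]
    simp [Pi.single_apply, Finset.sum_apply]
  conv_lhs => rw [hy y, hy z]
  simp only [map_sum, map_smul, sum_apply, smul_apply, smul_eq_mul, Finset.mul_sum]
  rw [Finset.sum_comm]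
  exact Finset.sum_congr rfl fun i _ => Finset.sum_congr rfl fun j _ => by ring

theorem apply_add_apply_cplx {S : (Fin 4 → ℝ) →L[ℝ] (Fin 4 → ℝ) →L[ℝ] ℝ}
    (hS : ∀ y z, S y z = S z y) (y z : Fin 4 → ℝ) :
    S y z + S (cplx y) (cplx z) = hermVec (hermPart S) y ⬝ᵥ z := by
  rw [bilin_expand S y z, bilin_expand S (cplx y) (cplx z)]
  simp only [Fin.sum_univ_four, dotProduct, hermVec, hermPart, cplx, Matrix.cons_val]
  rw [hS (Pi.single 1 1) (Pi.single 0 1), hS (Pi.single 2 1) (Pi.single 0 1),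
    hS (Pi.single 3 1) (Pi.single 0 1), hS (Pi.single 2 1) (Pi.single 1 1),
    hS (Pi.single 3 1) (Pi.single 1 1), hS (Pi.single 3 1) (Pi.single 2 1)]
  ring

theorem hermPolar_hermPart {S : (Fin 4 → ℝ) →L[ℝ] (Fin 4 → ℝ) →L[ℝ] ℝ}
    (hS : ∀ y z, S y z = S z y) (m : Fin 4 → ℝ) :
    hermDet m * (S (Pi.single 0 1) (Pi.single 0 1) + S (Pi.single 2 1) (Pi.single 2 1))
      + (S (cofDir m) (cofDir m) + S (cplx (cofDir m)) (cplx (cofDir m))) =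
    m 0 * hermPolar m (hermPart S) := by
  rw [apply_add_apply_cplx hS]
  simp only [Fin.sum_univ_four, dotProduct, hermVec, hermPart, cofDir, hermDet, hermPolar,
    Matrix.cons_val]
  ring

theorem hermVec_dot_varVec {k : ℝ} {a : Fin 4 → ℝ} (hk : k * hermDet a = 1) (m f : Fin 4 → ℝ) :
    4 * (hermVec m f ⬝ᵥ varVec k a m f) + 2 * (hermVec a (varVec k a m f) ⬝ᵥ varVec k a m f) =
      -2 * k * (hermVec (hermCof a) (hermVec m f) ⬝ᵥ hermVec m f) := by
  generalize hg : hermVec m f = g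
  simp only [varVec, hg]
  simp only [Fin.sum_univ_four, dotProduct, hermVec, hermCof, hermDet, Pi.smul_apply, smul_eq_mul,
    Matrix.cons_val] at hk ⊢
  linear_combination (2 * k * ((a 1 * g 0 + -a 2 * g 1 + -a 3 * g 3) * g 0
    + (-a 2 * g 0 + a 0 * g 1 - -a 3 * g 2) * g 1
    + (- -a 3 * g 1 + a 1 * g 2 + -a 2 * g 3) * g 2
    + (-a 3 * g 0 + -a 2 * g 2 + a 0 * g 3) * g 3)) * hk

theorem trace_varVec {k lam : ℝ} {a b m p : Fin 4 → ℝ} (hk : k * hermDet a = 1)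
    (hab : a = b + rankOne p p) (hdet : hermDet b = lam) (hm : hermPolar b m = 0) :
    lam * (4 * (hermVec m (Pi.single 0 1) ⬝ᵥ varVec k a m (Pi.single 0 1)) +
        2 * (hermVec a (varVec k a m (Pi.single 0 1)) ⬝ᵥ varVec k a m (Pi.single 0 1))) +
      (4 * (hermVec m (cofDir b) ⬝ᵥ varVec k a m (cofDir b)) +
        2 * (hermVec a (varVec k a m (cofDir b)) ⬝ᵥ varVec k a m (cofDir b))) =
      2 * b 0 * hermDet m * (1 + lam * k) := by
  rw [hermVec_dot_varVec hk, hermVec_dot_varVec hk]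
  have hpol : hermPolar a b = hermDet a + lam := by
    rw [← hdet, hab]
    simp only [hermPolar, hermDet, rankOne, Pi.add_apply, Matrix.cons_val]
    ring
  have h1 : lam * (hermVec (hermCof a) (hermVec m (Pi.single 0 1)) ⬝ᵥ hermVec m (Pi.single 0 1)) +
      hermVec (hermCof a) (hermVec m (cofDir b)) ⬝ᵥ hermVec m (cofDir b) =
      - b 0 * hermDet m * hermPolar a b + b 0 * hermPolar b m * hermPolar a m := by
    rw [← hdet]
    simp only [hermPolar, hermDet, hermVec, hermCof, cofDir, dotProduct, Fin.sum_univ_four,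
      Matrix.cons_val, Pi.single_apply]
    simp
    ring
  rw [hpol, hm] at h1
  linear_combination (-2 * k) * h1 + 2 * b 0 * hermDet m * hk

theorem hermDet_of_hermPolar_eq_zero {b m : Fin 4 → ℝ} (hm : hermPolar b m = 0) :
    -(b 0 ^ 2 * hermDet m) = hermDet b * m 0 ^ 2 + (b 0 * m 2 - b 2 * m 0) ^ 2
      + (b 0 * m 3 - b 3 * m 0) ^ 2 := by
  simp only [hermPolar, hermDet] at *
  linear_combination -(b 0 * m 0) * hm

end HermitianForms

section StarForm

/-- The coordinates of a linear form. -/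
noncomputable def coords (L : (Fin 4 → ℝ) →L[ℝ] ℝ) : Fin 4 → ℝ := fun i => L (Pi.single i 1)

theorem apply_eq_coords_dot (L : (Fin 4 → ℝ) →L[ℝ] ℝ) (y : Fin 4 → ℝ) : L y = coords L ⬝ᵥ y := by
  have hy : y = ∑ i, y i • Pi.single i (1 : ℝ) := by
    rw [pi_eq_sum_univ' y]
    simp [Pi.single_apply, Finset.sum_apply]
  conv_lhs => rw [hy]
  simp only [map_sum, map_smul, smul_eq_mul, coords, dotProduct, mul_comm]

/-- The Hermitian form whose determinant is prescribed by equation (★). -/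
noncomputable def starForm (v : (Fin 4 → ℝ) → ℝ) (x : Fin 4 → ℝ) : Fin 4 → ℝ :=
  hermPart (d2 v x) - rankOne (coords (fderiv ℝ v x)) (coords (fderiv ℝ v x))

/-- The derivative of `starForm v` in the direction `e`. -/
noncomputable def starForm₁ (v : (Fin 4 → ℝ) → ℝ) (e x : Fin 4 → ℝ) : Fin 4 → ℝ :=
  hermPart (d3 v x e) - (2 : ℝ) • rankOne (coords (fderiv ℝ v x)) (coords (d2 v x e))

/-- The second derivative of `starForm v` in the direction `e`. -/
noncomputable def starForm₂ (v : (Fin 4 → ℝ) → ℝ) (e x : Fin 4 → ℝ) : Fin 4 → ℝ :=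
  hermPart (d4 v x e e) - (2 : ℝ) • rankOne (coords (fderiv ℝ v x)) (coords (d3 v x e e))
    - (2 : ℝ) • rankOne (coords (d2 v x e)) (coords (d2 v x e))

theorem pd2_eq_d2 {v : (Fin 4 → ℝ) → ℝ} {x : Fin 4 → ℝ}
    (hv : ContDiffAt ℝ 4 v x) (i j : Fin 4) :
    pd2 v i j x = d2 v x (Pi.single i 1) (Pi.single j 1) := by
  have := (hasFDerivAt_fderiv_apply (hv.of_le (by norm_num)) (Pi.single i (1 : ℝ))).fderiv
  simp only [pd2, pd, this, ContinuousLinearMap.flip_apply]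
  exact d2_symm hv _ _

theorem hermDet_starForm {v : (Fin 4 → ℝ) → ℝ} {Ω : Set (Fin 4 → ℝ)} {lam : ℝ}
    (hstar : StarEq lam v Ω) {x : Fin 4 → ℝ} (hx : x ∈ Ω) (hv : ContDiffAt ℝ 4 v x) :
    hermDet (starForm v x) = lam := by
  have := hstar x hx
  simp only [pd2_eq_d2 hv, pd] at this
  rw [← this]
  simp only [hermDet, starForm, hermPart, rankOne, coords, Pi.sub_apply, Matrix.cons_val]
  ring

theorem hermDet_hermPart_ge {S : (Fin 4 → ℝ) →L[ℝ] (Fin 4 → ℝ) →L[ℝ] ℝ}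
    (hS : ∀ y z, S y z = S z y) (hpos : ∀ y, 0 ≤ S y y) (p : Fin 4 → ℝ) {lam : ℝ} (hlam : 0 < lam)
    (hdet : hermDet (hermPart S - rankOne p p) = lam) :
    lam ≤ hermDet (hermPart S) ∧ 0 < (hermPart S - rankOne p p) 0 ∧
      0 < (hermPart S - rankOne p p) 1 := by
  have hq : 0 ≤ hermPolar (hermPart S) (rankOne p p) := by
    have h := apply_add_apply_cplx hS ![p 1, -p 0, -p 3, p 2] ![p 1, -p 0, -p 3, p 2]
    have h1 := add_nonneg (hpos ![p 1, -p 0, -p 3, p 2]) (hpos (cplx ![p 1, -p 0, -p 3, p 2]))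
    rw [h] at h1
    refine h1.trans_eq ?_
    simp only [hermPolar, rankOne, hermVec, dotProduct, Fin.sum_univ_four, Matrix.cons_val]
    ring
  have ha0 : 0 ≤ hermPart S 0 := add_nonneg (hpos _) (hpos _)
  have ha1 : 0 ≤ hermPart S 1 := add_nonneg (hpos _) (hpos _)
  generalize hermPart S = a at *
  obtain ⟨b, rfl⟩ : ∃ b, a = b + rankOne p p := ⟨a - rankOne p p, by simp⟩
  have hP : (rankOne p p 2) ^ 2 + (rankOne p p 3) ^ 2 = rankOne p p 0 * rankOne p p 1 := by
    simp only [rankOne, Matrix.cons_val]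
    ring
  have hP0 : 0 ≤ rankOne p p 0 := by
    simp only [rankOne, Matrix.cons_val]
    nlinarith [sq_nonneg (p 0), sq_nonneg (p 2)]
  have hP1 : 0 ≤ rankOne p p 1 := by
    simp only [rankOne, Matrix.cons_val]
    nlinarith [sq_nonneg (p 1), sq_nonneg (p 3)]
  generalize rankOne p p = P at *
  simp only [add_sub_cancel_right] at *
  simp only [hermDet, hermPolar, Pi.add_apply] at *
  have hb01 : 0 < b 0 * b 1 := by nlinarith [sq_nonneg (b 2), sq_nonneg (b 3)]
  refine ⟨by nlinarith, ?_⟩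
  rcases mul_pos_iff.1 hb01 with h | ⟨h0, h1⟩
  · exact h
  · exfalso
    have hP0' : 0 < P 0 := by linarith
    have hP1' : 0 < P 1 := by linarith
    have hu : 0 < -(b 0 * P 1 + b 1 * P 0) := by nlinarith
    have hs : -(b 0 * P 1 + b 1 * P 0) ≤ -2 * b 2 * P 2 - 2 * b 3 * P 3 := by nlinarith
    have hsq := mul_self_le_mul_self hu.le hs
    have hcs : (b 2 * P 2 + b 3 * P 3) ^ 2 ≤ (b 0 * b 1 - lam) * (P 0 * P 1) := by
      rw [← hP, ← hdet]
      nlinarith [sq_nonneg (b 2 * P 3 - b 3 * P 2)]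
    nlinarith [sq_nonneg (b 0 * P 1 - b 1 * P 0), mul_pos hlam (mul_pos hP0' hP1')]

theorem hermPolar_of_hermDet_eq_const {lam : ℝ} {B B₁ : ℝ → Fin 4 → ℝ} {B₂ : Fin 4 → ℝ}
    (h : ∀ᶠ s in 𝓝 0, hermDet (B s) = lam) (h1 : ∀ᶠ s in 𝓝 0, HasDerivAt B (B₁ s) s)
    (h2 : HasDerivAt B₁ B₂ 0) :
    hermPolar (B 0) (B₁ 0) = 0 ∧ hermPolar (B 0) B₂ + 2 * hermDet (B₁ 0) = 0 := by
  have hd : ∀ᶠ s in 𝓝 0, hermPolar (B s) (B₁ s) = 0 := by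
    filter_upwards [h.eventually_nhds, h1] with s hs hs1
    have hB := hasDerivAt_pi.1 hs1
    have hdet : HasDerivAt (fun t => hermDet (B t)) (hermPolar (B s) (B₁ s)) s := by
      refine ((((hB 0).mul (hB 1)).sub ((hB 2).pow 2)).sub ((hB 3).pow 2)).congr_deriv ?_
      simp only [hermPolar]
      ring
    have hc : HasDerivAt (fun t => hermDet (B t)) 0 s :=
      (hasDerivAt_const s lam).congr_of_eventuallyEq hs
    exact hdet.unique hc
  refine ⟨hd.self_of_nhds, ?_⟩
  have hB := hasDerivAt_pi.1 h1.self_of_nhds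
  have hB1 := hasDerivAt_pi.1 h2
  have hpol : HasDerivAt (fun t => hermPolar (B t) (B₁ t))
      (hermPolar (B 0) B₂ + 2 * hermDet (B₁ 0)) 0 := by
    refine (((((hB 0).mul (hB1 1)).add ((hB 1).mul (hB1 0))).sub
      (((hB 2).const_mul 2).mul (hB1 2))).sub (((hB 3).const_mul 2).mul (hB1 3))).congr_deriv ?_
    simp only [hermPolar, hermDet]
    ring
  have hc : HasDerivAt (fun t => hermPolar (B t) (B₁ t)) 0 0 :=
    (hasDerivAt_const 0 0).congr_of_eventuallyEq hd
  exact hpol.unique hc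

theorem hasDerivAt_coords {L : ℝ → (Fin 4 → ℝ) →L[ℝ] ℝ} {L' : (Fin 4 → ℝ) →L[ℝ] ℝ} {t : ℝ}
    (h : ∀ a, HasDerivAt (fun s => L s a) (L' a) t) (i : Fin 4) :
    HasDerivAt (fun s => coords (L s) i) (coords L' i) t :=
  h _

theorem hasDerivAt_rankOne {p q : ℝ → Fin 4 → ℝ} {p' q' : Fin 4 → ℝ} {t : ℝ}
    (hp : ∀ i, HasDerivAt (fun s => p s i) (p' i) t)
    (hq : ∀ i, HasDerivAt (fun s => q s i) (q' i) t) (i : Fin 4) :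
    HasDerivAt (fun s => rankOne (p s) (q s) i) ((rankOne p' (q t) + rankOne (p t) q') i) t := by
  fin_cases i
  · refine (((hp 0).mul (hq 0)).add ((hp 2).mul (hq 2))).congr_deriv ?_
    simp [rankOne]
    ring
  · refine (((hp 1).mul (hq 1)).add ((hp 3).mul (hq 3))).congr_deriv ?_
    simp [rankOne]
    ring
  · refine ((((((hp 0).mul (hq 1)).add ((hq 0).mul (hp 1))).add ((hp 2).mul (hq 3))).add
      ((hq 2).mul (hp 3))).div_const 2).congr_deriv ?_
    simp [rankOne]
    ring
  · refine ((((((hp 0).mul (hq 3)).add ((hq 0).mul (hp 3))).sub ((hp 1).mul (hq 2))).sub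
      ((hq 1).mul (hp 2))).div_const 2).congr_deriv ?_
    simp [rankOne]
    ring

theorem hasDerivAt_hermPart {S : ℝ → (Fin 4 → ℝ) →L[ℝ] (Fin 4 → ℝ) →L[ℝ] ℝ}
    {S' : (Fin 4 → ℝ) →L[ℝ] (Fin 4 → ℝ) →L[ℝ] ℝ} {t : ℝ}
    (h : ∀ a b, HasDerivAt (fun s => S s a b) (S' a b) t) (i : Fin 4) :
    HasDerivAt (fun s => hermPart (S s) i) (hermPart S' i) t := by
  fin_cases i
  · exact (h _ _).add (h _ _)
  · exact (h _ _).add (h _ _)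
  · exact (h _ _).add (h _ _)
  · exact (h _ _).sub (h _ _)

theorem rankOne_comm (p q : Fin 4 → ℝ) : rankOne p q = rankOne q p := by
  ext i
  fin_cases i <;> simp [rankOne] <;> ring

theorem hermPolar_starForm {v : (Fin 4 → ℝ) → ℝ} {Ω : Set (Fin 4 → ℝ)} {lam : ℝ} (hΩ : IsOpen Ω)
    (hstar : StarEq lam v Ω) {x : Fin 4 → ℝ} (hx : x ∈ Ω) (hv : ContDiffAt ℝ 4 v x)
    (e : Fin 4 → ℝ) :
    hermPolar (starForm v x) (starForm₁ v e x) = 0 ∧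
      hermPolar (starForm v x) (starForm₂ v e x) + 2 * hermDet (starForm₁ v e x) = 0 := by
  have hev := eventually_line_contDiffAt hv e
  have hd2 : ∀ {t : ℝ}, ContDiffAt ℝ 4 v (x + t • e) → ∀ i,
      HasDerivAt (fun s => coords (fderiv ℝ v (x + s • e)) i) (coords (d2 v (x + t • e) e) i) t :=
    fun ht => hasDerivAt_coords fun a => hasDerivAt_fderiv_line ht a
  have key := hermPolar_of_hermDet_eq_const (lam := lam) (B := fun s => starForm v (x + s • e))
    (B₁ := fun s => starForm₁ v e (x + s • e)) (B₂ := starForm₂ v e (x + (0 : ℝ) • e)) ?_ ?_ ?_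
  · simpa using key
  · filter_upwards [hev, (tendsto_line x e).eventually (hΩ.mem_nhds hx)] with s hs hs'
    exact hermDet_starForm hstar hs' hs
  · filter_upwards [hev] with s hs
    refine hasDerivAt_pi.2 fun i => ?_
    refine ((hasDerivAt_hermPart (hasDerivAt_d2_line hs) i).sub
      (hasDerivAt_rankOne (hd2 hs) (hd2 hs) i)).congr_deriv ?_
    rw [rankOne_comm (coords (d2 v (x + s • e) e))]
    simp only [starForm₁, Pi.sub_apply, Pi.smul_apply, Pi.add_apply, smul_eq_mul]
    ring
  · have hv0 : ContDiffAt ℝ 4 v (x + (0 : ℝ) • e) := by simpa using hv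
    refine hasDerivAt_pi.2 fun i => ?_
    refine ((hasDerivAt_hermPart (hasDerivAt_d3_line hv0 e) i).sub
      ((hasDerivAt_rankOne (hd2 hv0)
        (hasDerivAt_coords fun a => hasDerivAt_d2_line hv0 e a) i).const_mul 2)).congr_deriv ?_
    simp only [starForm₂, Pi.sub_apply, Pi.smul_apply, Pi.add_apply, smul_eq_mul]
    ring

end StarForm

section TraceInequality

/-- The directions diagonalizing the cofactor matrix of `b`. -/
def starDirs (b : Fin 4 → ℝ) : Set (Fin 4 → ℝ) :=
  {Pi.single 0 1, Pi.single 2 1, cofDir b, cplx (cofDir b)}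

/-- The weighted trace of a quadratic form along the directions diagonalizing the cofactor matrix
of `b`; it is the linearization of equation (★). -/
noncomputable def starTrace (lam : ℝ) (b : Fin 4 → ℝ) (ℓ : (Fin 4 → ℝ) → ℝ) : ℝ :=
  lam * (ℓ (Pi.single 0 1) + ℓ (Pi.single 2 1)) + (ℓ (cofDir b) + ℓ (cplx (cofDir b)))

/-- The coefficient of the eigenvalue in the error term of the linearized equation. -/
noncomputable def errVal (lam k μ : ℝ) (p b m e : Fin 4 → ℝ) : ℝ :=
  2 * b 0 * μ * hermPolar b (rankOne e e) +
    8 * (lam * (hermVec (rankOne p e) (Pi.single 0 1) ⬝ᵥ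
        varVec k (b + rankOne p p) m (Pi.single 0 1)) +
      hermVec (rankOne p e) (cofDir b) ⬝ᵥ varVec k (b + rankOne p p) m (cofDir b))

/-- The part of the error term of the linearized equation which is linear in the gradient. -/
noncomputable def errGrad (lam k : ℝ) (p b m e g : Fin 4 → ℝ) : ℝ :=
  2 * b 0 * hermPolar b (rankOne p g) -
    4 * (lam * ((g ⬝ᵥ Pi.single 0 1) * (e ⬝ᵥ varVec k (b + rankOne p p) m (Pi.single 0 1)) +
        (g ⬝ᵥ Pi.single 2 1) * (e ⬝ᵥ cplx (varVec k (b + rankOne p p) m (Pi.single 0 1)))) +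
      ((g ⬝ᵥ cofDir b) * (e ⬝ᵥ varVec k (b + rankOne p p) m (cofDir b)) +
        (g ⬝ᵥ cplx (cofDir b)) * (e ⬝ᵥ cplx (varVec k (b + rankOne p p) m (cofDir b)))))

theorem cplx_single_zero : cplx (Pi.single 0 1) = Pi.single 2 1 := by
  ext i
  fin_cases i <;> simp [cplx]

theorem starTrace_le {A Q X : (Fin 4 → ℝ) →L[ℝ] (Fin 4 → ℝ) →L[ℝ] ℝ}
    (hA : ∀ y z, A y z = A z y) (hQ : ∀ y z, Q y z = Q z y) (hX : ∀ y z, X y z = X z y)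
    {lam k μ : ℝ} {p b m e g : Fin 4 → ℝ} {ℓ : (Fin 4 → ℝ) → ℝ} (hlam : 0 < lam)
    (hk : k * hermDet (hermPart A) = 1) (ha : hermPart A = b + rankOne p p)
    (hdet : hermDet b = lam) (hXm : hermPart X = m + (2 * μ) • rankOne p e)
    (hm : hermPolar b m = 0)
    (hQm : hermPolar b (hermPart Q - (2 : ℝ) • rankOne p g - (2 * μ ^ 2) • rankOne e e)
      + 2 * hermDet m = 0)
    (H : ∀ ξ ∈ starDirs b, ∀ y, 0 ≤ Q ξ ξ + 4 * X ξ y + 2 * A y y - ℓ ξ - 4 * (g ⬝ᵥ ξ) * (e ⬝ᵥ y)) :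
    starTrace lam b ℓ ≤
      2 * b 0 * lam * k * hermDet m + μ * errVal lam k μ p b m e + errGrad lam k p b m e g := by
  have hQtr := hermPolar_hermPart hQ b
  rw [hdet] at hQtr
  have hpol : hermPolar b (hermPart Q) =
      -2 * hermDet m + 2 * hermPolar b (rankOne p g) + 2 * μ ^ 2 * hermPolar b (rankOne e e) := by
    simp only [hermPolar, Pi.sub_apply, Pi.smul_apply, smul_eq_mul] at hQm ⊢
    linear_combination hQm
  have htr := trace_varVec hk ha hdet hm
  have hXf : ∀ f y, X f y + X (cplx f) (cplx y) =
      hermVec m f ⬝ᵥ y + 2 * μ * (hermVec (rankOne p e) f ⬝ᵥ y) := fun f y => by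
    rw [apply_add_apply_cplx hX, hXm]
    simp only [hermVec, dotProduct, Fin.sum_univ_four, Pi.add_apply, Pi.smul_apply, smul_eq_mul,
      Matrix.cons_val]
    ring
  have hAf := fun y => apply_add_apply_cplx hA y y
  rw [ha] at htr hAf
  set y₀ := varVec k (b + rankOne p p) m (Pi.single 0 1) with hy₀
  set y₁ := varVec k (b + rankOne p p) m (cofDir b) with hy₁
  have h0 := H (Pi.single 0 1) (by simp [starDirs]) y₀
  have h2 := H (Pi.single 2 1) (by simp [starDirs]) (cplx y₀)
  have h1 := H (cofDir b) (by simp [starDirs]) y₁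
  have h3 := H (cplx (cofDir b)) (by simp [starDirs]) (cplx y₁)
  have hX0 := hXf (Pi.single 0 1) y₀
  have hX1 := hXf (cofDir b) y₁
  have hA0 := hAf y₀
  have hA1 := hAf y₁
  rw [cplx_single_zero] at hX0
  have h02 := mul_nonneg hlam.le (add_nonneg h0 h2)
  simp only [starTrace, errVal, errGrad, ← hy₀, ← hy₁]
  rw [hpol] at hQtr
  linear_combination h02 + h1 + h3 + hQtr + 4 * lam * hX0 + 4 * hX1 + 2 * lam * hA0 + 2 * hA1 + htr

theorem errGrad_eq_sum (lam k : ℝ) (p b m e g : Fin 4 → ℝ) :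
    errGrad lam k p b m e g = ∑ i, g i * errGrad lam k p b m e (Pi.single i 1) := by
  simp only [errGrad]
  generalize varVec k (b + rankOne p p) m (Pi.single 0 1) = y₀
  generalize varVec k (b + rankOne p p) m (cofDir b) = y₁
  generalize e ⬝ᵥ y₀ = s₁
  generalize e ⬝ᵥ y₁ = s₂
  generalize e ⬝ᵥ cplx y₀ = s₃
  generalize e ⬝ᵥ cplx y₁ = s₄
  simp [Fin.sum_univ_four, dotProduct, Pi.single_apply, hermPolar, rankOne, cofDir, cplx]
  ring

end TraceInequality

section Touching

variable {v : (Fin 4 → ℝ) → ℝ} {Ω : Set (Fin 4 → ℝ)} {lam : ℝ} {x : Fin 4 → ℝ}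

/-- The inverse determinant of the complex Hessian. -/
noncomputable def invDet (v : (Fin 4 → ℝ) → ℝ) (x : Fin 4 → ℝ) : ℝ :=
  (hermDet (hermPart (d2 v x)))⁻¹

/-- The error term `errVal` for the solution `v` at `x` in the direction `e`. -/
noncomputable def solErrVal (lam : ℝ) (v : (Fin 4 → ℝ) → ℝ) (x e : Fin 4 → ℝ) : ℝ :=
  errVal lam (invDet v x) (d2 v x e e) (coords (fderiv ℝ v x)) (starForm v x) (starForm₁ v e x) e

/-- The error term `errGrad` for the solution `v` at `x` in the direction `e`. -/
noncomputable def solErrGrad (lam : ℝ) (v : (Fin 4 → ℝ) → ℝ) (x e g : Fin 4 → ℝ) : ℝ :=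
  errGrad lam (invDet v x) (coords (fderiv ℝ v x)) (starForm v x) (starForm₁ v e x) e g

theorem solErrGrad_eq_sum (lam : ℝ) (v : (Fin 4 → ℝ) → ℝ) (x e g : Fin 4 → ℝ) :
    solErrGrad lam v x e g = ∑ i, g i * solErrGrad lam v x e (Pi.single i 1) :=
  errGrad_eq_sum _ _ _ _ _ _ _

theorem hermDet_starForm₁_nonpos (hΩ : IsOpen Ω) (hstar : StarEq lam v Ω) (hlam : 0 < lam)
    (hx : x ∈ Ω) (hv : ContDiffAt ℝ 4 v x) (hpos : ∀ y, 0 ≤ d2 v x y y) (e : Fin 4 → ℝ) :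
    hermDet (starForm₁ v e x) ≤ 0 := by
  have hdet := hermDet_starForm hstar hx hv
  have hge := hermDet_hermPart_ge (d2_symm hv) hpos (coords (fderiv ℝ v x)) hlam hdet
  have h := hermDet_of_hermPolar_eq_zero (hermPolar_starForm hΩ hstar hx hv e).1
  rw [hdet] at h
  have hb : 0 < starForm v x 0 := hge.2.1
  by_contra! hc
  nlinarith [mul_pos (pow_pos hb 2) hc, mul_nonneg hlam.le (sq_nonneg (starForm₁ v e x 0)),
    sq_nonneg (starForm v x 0 * starForm₁ v e x 2 - starForm v x 2 * starForm₁ v e x 0),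
    sq_nonneg (starForm v x 0 * starForm₁ v e x 3 - starForm v x 3 * starForm₁ v e x 0)]

theorem starTrace_le_of_variation (hΩ : IsOpen Ω) (hstar : StarEq lam v Ω) (hlam : 0 < lam)
    (hx : x ∈ Ω) (hv : ContDiffAt ℝ 4 v x) (hpos : ∀ y, 0 ≤ d2 v x y y) {e : Fin 4 → ℝ}
    {ℓ : (Fin 4 → ℝ) → ℝ} {μ : ℝ} (he : ∀ z, d2 v x e z = μ * (e ⬝ᵥ z))
    (H : ∀ ξ ∈ starDirs (starForm v x), ∀ y, 0 ≤ d4 v x ξ ξ e e + 4 * d3 v x ξ e y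
      + 2 * d2 v x y y - ℓ ξ - 4 * d3 v x ξ e e * (e ⬝ᵥ y)) :
    starTrace lam (starForm v x) ℓ ≤
      2 * starForm v x 0 * lam * invDet v x * hermDet (starForm₁ v e x) +
      μ * errVal lam (invDet v x) μ (coords (fderiv ℝ v x)) (starForm v x) (starForm₁ v e x) e +
      solErrGrad lam v x e (coords (d3 v x e e)) := by
  have hdet := hermDet_starForm hstar hx hv
  have hge := hermDet_hermPart_ge (d2_symm hv) hpos (coords (fderiv ℝ v x)) hlam hdet
  have hcoords : coords (d2 v x e) = μ • e := by
    ext i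
    simp [coords, he]
  have hpol := hermPolar_starForm hΩ hstar hx hv e
  refine starTrace_le (d2_symm hv) (Q := d4 v x e e) (X := d3 v x e) (d4_symm_right hv e e)
    (d3_symm_right hv e) hlam (inv_mul_cancel₀ (hlam.trans_le hge.1).ne') (by simp [starForm])
    hdet ?_ hpol.1 ?_ ?_
  · ext i
    simp only [starForm₁, hcoords, Pi.add_apply, Pi.sub_apply, Pi.smul_apply, smul_eq_mul]
    fin_cases i <;> simp [rankOne] <;> ring
  · convert hpol.2 using 3
    ext i
    simp only [starForm₂, hcoords, Pi.sub_apply, Pi.smul_apply, smul_eq_mul]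
    fin_cases i <;> simp [rankOne] <;> ring
  · intro ξ hξ y
    have := H ξ hξ y
    rwa [d4_swap hv, d3_symm_left hv ξ e e, d3_symm_right hv e ξ e, d3_symm_left hv ξ e y,
      apply_eq_coords_dot (d3 v x e e)] at this

theorem null_direction (hΩ : IsOpen Ω) (hstar : StarEq lam v Ω) (hlam : 0 < lam)
    (hx : x ∈ Ω) (hv : ContDiffAt ℝ 4 v x) (hpos : ∀ z ∈ Ω, ∀ y, 0 ≤ d2 v z y y)
    {n : Fin 4 → ℝ} (hn : d2 v x n n = 0) :
    (∀ y, d2 v x n y = 0) ∧ (∀ ξ, d3 v x ξ n n = 0) ∧ ∀ ξ ∈ starDirs (starForm v x),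
      d4 v x ξ ξ n n = 0 ∧ ∀ y, d3 v x ξ n y = 0 := by
  have hray : ∀ ξ y, d3 v x ξ n n + 2 * d2 v x n y = 0 ∧
      0 ≤ d4 v x ξ ξ n n + 4 * d3 v x ξ n y + 2 * d2 v x y y := fun ξ y => by
    have hc : ∀ z : Fin 4 → ℝ, d2 (fun _ : Fin 4 → ℝ => (0 : ℝ)) z = 0 := fun z => by
      simp [d2]
    have h := rayleigh_second_order hv (h := fun _ => 0) contDiffAt_const (n := 0) (e := n)
      (y := y) (ξ := ξ) (by simp [hn]) (by
        filter_upwards [(tendsto_line x ξ).eventually (hΩ.mem_nhds hx)] with t ht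
        simpa using hpos _ ht (n + t • y))
    simpa [hc] using h
  have h3 : ∀ ξ, d3 v x ξ n n = 0 := fun ξ => by simpa using (hray ξ 0).1
  have h2 : ∀ y, d2 v x n y = 0 := fun y => by simpa [h3] using (hray 0 y).1
  refine ⟨h2, h3, ?_⟩
  have hcoords : coords (d2 v x n) = 0 := by
    ext i
    simp [coords, h2]
  have hcoords3 : coords (d3 v x n n) = 0 := by
    ext i
    simp only [coords, Pi.zero_apply]
    rw [d3_symm_right hv, d3_symm_left hv]
    exact (d3_symm_right hv _ _ _).trans (h3 _)
  have hdet := hermDet_starForm hstar hx hv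
  have hge := hermDet_hermPart_ge (d2_symm hv) (hpos x hx) (coords (fderiv ℝ v x)) hlam hdet
  have htr := starTrace_le_of_variation hΩ hstar hlam hx hv (hpos x hx) (e := n) (ℓ := 0) (μ := 0)
    (by simpa using h2) fun ξ _ y => by simpa [h3] using (hray ξ y).2
  have hgrad : solErrGrad lam v x n 0 = 0 := by
    rw [solErrGrad_eq_sum]
    simp
  have hm : hermDet (starForm₁ v n x) = 0 := by
    refine le_antisymm (hermDet_starForm₁_nonpos hΩ hstar hlam hx hv (hpos x hx) n) ?_
    have hk : 0 < 2 * starForm v x 0 * lam * invDet v x :=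
      mul_pos (mul_pos (mul_pos two_pos hge.2.1) hlam) (inv_pos.2 (hlam.trans_le hge.1))
    rw [hcoords3, hgrad] at htr
    simp only [starTrace, Pi.zero_apply, add_zero, mul_zero, zero_mul] at htr
    exact nonneg_of_mul_nonneg_right htr hk
  have hpol := (hermPolar_starForm hΩ hstar hx hv n).2
  have hR : ∀ q, rankOne q 0 = 0 := fun q => by
    ext i
    fin_cases i <;> simp [rankOne]
  rw [starForm₂, hcoords, hcoords3, hm, hR, hR] at hpol
  simp only [smul_zero, sub_zero, mul_zero, add_zero] at hpol
  have hQ := hermPolar_hermPart (d4_symm_right hv n n) (starForm v x)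
  rw [hpol, hdet, mul_zero] at hQ
  simp only [d4_swap hv n] at hQ
  have hQpos : ∀ ξ, 0 ≤ d4 v x ξ ξ n n := fun ξ => by simpa using (hray ξ 0).2
  have hQ0 := hQpos (Pi.single 0 1)
  have hQ2 := hQpos (Pi.single 2 1)
  have hQz := hQpos (cofDir (starForm v x))
  have hQw := hQpos (cplx (cofDir (starForm v x)))
  have hfirst : d4 v x (Pi.single 0 1) (Pi.single 0 1) n n +
      d4 v x (Pi.single 2 1) (Pi.single 2 1) n n = 0 := by
    refine le_antisymm ?_ (add_nonneg hQ0 hQ2)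
    by_contra! hc
    nlinarith [mul_pos hlam hc]
  rw [hfirst, mul_zero, zero_add] at hQ
  intro ξ hξ
  have hzero : d4 v x ξ ξ n n = 0 := by
    rcases hξ with rfl | rfl | rfl | rfl <;> linarith
  refine ⟨hzero, fun y => ?_⟩
  have hvar : ∀ t : ℝ, 0 ≤ 4 * (t * d3 v x ξ n y) + 2 * (t * (t * d2 v x y y)) := fun t => by
    simpa [hzero] using (hray ξ (t • y)).2
  by_contra hne
  have hD := hpos x hx y
  generalize d3 v x ξ n y = c at hvar hne
  generalize d2 v x y y = D at hvar hD
  have h1 := hvar (-c / (D + 1))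
  have hc : 0 < c ^ 2 := by positivity
  have h4 : 4 * (-c / (D + 1) * c) + 2 * (-c / (D + 1) * (-c / (D + 1) * D)) =
      -(c ^ 2 * (2 * D + 4)) / (D + 1) ^ 2 := by
    field_simp
    ring
  rw [h4] at h1
  have : 0 < c ^ 2 * (2 * D + 4) / (D + 1) ^ 2 := by positivity
  rw [neg_div] at h1
  linarith

theorem starTrace_le_of_touch (hΩ : IsOpen Ω) (hstar : StarEq lam v Ω) (hlam : 0 < lam)
    (hx : x ∈ Ω) (hv : ContDiffAt ℝ 4 v x) (hpos : ∀ z ∈ Ω, ∀ y, 0 ≤ d2 v z y y)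
    {n e : Fin 4 → ℝ} {h : (Fin 4 → ℝ) → ℝ} (hh : ContDiffAt ℝ 4 h x) (hn : n = 0 ∨ n ⬝ᵥ n = 1)
    (hnull : d2 v x n n = 0) (he : e ⬝ᵥ e = 1) (hne : n ⬝ᵥ e = 0) (hval : d2 v x e e = h x)
    (htouch : ∀ᶠ z in 𝓝 x, ∀ w, w ⬝ᵥ n = 0 →
      0 ≤ (d2 v z n n - h z) * (w ⬝ᵥ w) + d2 v z w w) :
    starTrace lam (starForm v x) (fun ξ => d2 h x ξ ξ) ≤
      h x * solErrVal lam v x e + solErrGrad lam v x e (coords (fderiv ℝ h x)) := by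
  obtain ⟨h2, h3, h4⟩ := null_direction hΩ hstar hlam hx hv hpos hnull
  have hen : e ⬝ᵥ n = 0 := by rw [dotProduct_comm, hne]
  have horth : ∀ y : Fin 4 → ℝ, (y - (y ⬝ᵥ n) • n) ⬝ᵥ n = 0 := fun y => by
    rcases hn with rfl | hn
    · simp
    · simp [sub_dotProduct, hn]
  have hdot : ∀ y : Fin 4 → ℝ, e ⬝ᵥ (y - (y ⬝ᵥ n) • n) = e ⬝ᵥ y := fun y => by
    simp [dotProduct_sub, hen]
  have hray := fun ξ y => rayleigh_second_order hv hh (n := n) (e := e)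
    (y := y - (y ⬝ᵥ n) • n) (ξ := ξ) (by rw [hnull, he, hval]; ring) (by
      filter_upwards [(tendsto_line x ξ).eventually htouch] with t ht
      refine ht _ ?_
      rw [add_dotProduct, smul_dotProduct, horth, hen]
      simp)
  have hgrad : ∀ ξ, d3 v x ξ e e = fderiv ℝ h x ξ := fun ξ => by
    have := (hray ξ 0).1
    simp [h3, he] at this
    linarith
  have hd2n : ∀ y, d2 v x y n = 0 := fun y => by rw [d2_symm hv, h2]
  have heig : ∀ y, d2 v x e y = h x * (e ⬝ᵥ y) := fun y => by
    have := (hray 0 y).1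
    rw [hdot, hgrad, h3, he, hnull, map_sub, map_smul, hd2n] at this
    simp at this
    linarith
  have hμ : 0 ≤ h x := hval ▸ hpos x hx e
  have htr := starTrace_le_of_variation hΩ hstar hlam hx hv (hpos x hx)
    (ℓ := fun ξ => d2 h x ξ ξ - d4 v x ξ ξ n n) heig fun ξ hξ y => by
      have hy := (hray ξ y).2
      have h34 : d3 v x ξ e n = 0 := by rw [d3_symm_right hv, (h4 ξ hξ).2]
      have hyy : 0 ≤ h x * ((y - (y ⬝ᵥ n) • n) ⬝ᵥ (y - (y ⬝ᵥ n) • n)) :=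
        mul_nonneg hμ (by simpa using dotProduct_star_self_nonneg (y - (y ⬝ᵥ n) • n))
      rw [hdot, hnull, h3, he, ← hgrad] at hy
      simp only [map_sub, map_smul, sub_apply, smul_apply, h2, hd2n, h34, smul_zero, sub_zero] at hy
      linarith
  have hdir : starTrace lam (starForm v x) (fun ξ => d2 h x ξ ξ - d4 v x ξ ξ n n) =
      starTrace lam (starForm v x) fun ξ => d2 h x ξ ξ := by
    simp only [starTrace]
    rw [(h4 (Pi.single 0 1) (by simp [starDirs])).1, (h4 (Pi.single 2 1) (by simp [starDirs])).1,
      (h4 (cofDir _) (by simp [starDirs])).1, (h4 (cplx (cofDir _)) (by simp [starDirs])).1]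
    simp
  have hcoords : coords (d3 v x e e) = coords (fderiv ℝ h x) := by
    ext i
    simp only [coords]
    rw [← hgrad, d3_symm_right hv, d3_symm_left hv]
  rw [hdir, hcoords] at htr
  rw [solErrVal, hval]
  have hge := hermDet_hermPart_ge (d2_symm hv) (hpos x hx) (coords (fderiv ℝ v x)) hlam
    (hermDet_starForm hstar hx hv)
  have hk : 0 ≤ 2 * starForm v x 0 * lam * invDet v x :=
    (mul_pos (mul_pos (mul_pos two_pos hge.2.1) hlam) (inv_pos.2 (hlam.trans_le hge.1))).le
  have := mul_nonneg hk (neg_nonneg.2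
    (hermDet_starForm₁_nonpos hΩ hstar hlam hx hv (hpos x hx) e))
  linarith

end Touching

section Bounds

variable {X : Type*} [TopologicalSpace X]

@[fun_prop]
theorem Continuous.hermVec {f g : X → Fin 4 → ℝ} (hf : Continuous f) (hg : Continuous g) :
    Continuous fun x => hermVec (f x) (g x) := by
  refine continuous_pi fun i => ?_
  fin_cases i <;> simp [_root_.hermVec] <;> fun_prop

@[fun_prop]
theorem Continuous.rankOne {f g : X → Fin 4 → ℝ} (hf : Continuous f) (hg : Continuous g) :
    Continuous fun x => rankOne (f x) (g x) := by
  refine continuous_pi fun i => ?_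
  fin_cases i <;> simp [_root_.rankOne] <;> fun_prop

@[fun_prop]
theorem Continuous.hermPolar {f g : X → Fin 4 → ℝ} (hf : Continuous f) (hg : Continuous g) :
    Continuous fun x => hermPolar (f x) (g x) := by
  simp only [_root_.hermPolar]
  fun_prop

@[fun_prop]
theorem Continuous.hermDet {f : X → Fin 4 → ℝ} (hf : Continuous f) :
    Continuous fun x => hermDet (f x) := by
  simp only [_root_.hermDet]
  fun_prop

@[fun_prop]
theorem Continuous.hermCof {f : X → Fin 4 → ℝ} (hf : Continuous f) :
    Continuous fun x => hermCof (f x) := by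
  refine continuous_pi fun i => ?_
  fin_cases i <;> simp [_root_.hermCof] <;> fun_prop

@[fun_prop]
theorem Continuous.cofDir {f : X → Fin 4 → ℝ} (hf : Continuous f) :
    Continuous fun x => cofDir (f x) := by
  refine continuous_pi fun i => ?_
  fin_cases i <;> simp [_root_.cofDir] <;> fun_prop

@[fun_prop]
theorem Continuous.cplx {f : X → Fin 4 → ℝ} (hf : Continuous f) :
    Continuous fun x => cplx (f x) := by
  refine continuous_pi fun i => ?_
  fin_cases i <;> simp [_root_.cplx] <;> fun_prop

theorem continuous_errVal (lam : ℝ) : Continuous fun D : ℝ × ℝ × (Fin 4 → ℝ) × (Fin 4 → ℝ) ×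
    (Fin 4 → ℝ) × (Fin 4 → ℝ) => errVal lam D.1 D.2.1 D.2.2.1 D.2.2.2.1 D.2.2.2.2.1 D.2.2.2.2.2 := by
  simp only [errVal, varVec]
  fun_prop

theorem continuous_errGrad (lam : ℝ) (g : Fin 4 → ℝ) : Continuous fun D : ℝ × (Fin 4 → ℝ) ×
    (Fin 4 → ℝ) × (Fin 4 → ℝ) × (Fin 4 → ℝ) =>
      errGrad lam D.1 D.2.1 D.2.2.1 D.2.2.2.1 D.2.2.2.2 g := by
  simp only [errGrad, varVec]
  fun_prop

theorem continuousAt_hermPart {S : X → (Fin 4 → ℝ) →L[ℝ] (Fin 4 → ℝ) →L[ℝ] ℝ} {x : X}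
    (h : ∀ a b, ContinuousAt (fun z => S z a b) x) :
    ContinuousAt (fun z => hermPart (S z)) x := by
  refine continuousAt_pi.2 fun i => ?_
  fin_cases i
  · exact (h _ _).add (h _ _)
  · exact (h _ _).add (h _ _)
  · exact (h _ _).add (h _ _)
  · exact (h _ _).sub (h _ _)

theorem ContinuousAt.rankOne {f g : X → Fin 4 → ℝ} {x : X} (hf : ContinuousAt f x)
    (hg : ContinuousAt g x) : ContinuousAt (fun z => rankOne (f z) (g z)) x :=
  (Continuous.rankOne continuous_fst continuous_snd).continuousAt.comp (hf.prodMk hg)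

variable {v : (Fin 4 → ℝ) → ℝ} {Ω : Set (Fin 4 → ℝ)} {lam : ℝ} {x e : Fin 4 → ℝ}

theorem continuousAt_coords_fderiv (hv : ContDiffAt ℝ 4 v x) :
    ContinuousAt (fun z => coords (fderiv ℝ v z)) x :=
  continuousAt_pi.2 fun _ => (contDiffAt_fderiv hv).continuousAt.clm_apply continuousAt_const

theorem continuousAt_starForm (hv : ContDiffAt ℝ 4 v x) : ContinuousAt (starForm v) x :=
  (continuousAt_hermPart fun _ _ => ((contDiffAt_d2 hv).continuousAt.clm_apply
    continuousAt_const).clm_apply continuousAt_const).sub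
    ((continuousAt_coords_fderiv hv).rankOne (continuousAt_coords_fderiv hv))

theorem continuousAt_d3 (hv : ContDiffAt ℝ 4 v x) (a b : Fin 4 → ℝ) :
    ContinuousAt (fun z : (Fin 4 → ℝ) × (Fin 4 → ℝ) => d3 v z.1 z.2 a b) (x, e) := by
  have hsum : ∀ z : (Fin 4 → ℝ) × (Fin 4 → ℝ),
      d3 v z.1 z.2 a b = ∑ i, z.2 i * d3 v z.1 (Pi.single i 1) a b := fun z => by
    have hz : z.2 = ∑ i, z.2 i • Pi.single i (1 : ℝ) := by
      rw [pi_eq_sum_univ' z.2]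
      simp [Pi.single_apply, Finset.sum_apply]
    conv_lhs => rw [hz]
    simp [d3, map_sum, map_smul, sum_apply]
  simp only [hsum]
  refine tendsto_finsetSum _ fun i _ => ?_
  refine ContinuousAt.mul (by fun_prop) ?_
  have h : ContinuousAt (fun y => d3 v y (Pi.single i 1)) x :=
    (hasFDerivAt_fderiv_apply (contDiffAt_d2 hv) (Pi.single i (1 : ℝ))).continuousAt
  have h' : ContinuousAt (fun y => d3 v y (Pi.single i 1) a b) x :=
    (h.clm_apply continuousAt_const).clm_apply continuousAt_const
  exact ContinuousAt.comp (x := (x, e)) (f := Prod.fst) h' continuousAt_fst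

theorem continuousAt_d2 (hv : ContDiffAt ℝ 4 v x) :
    ContinuousAt (fun z : (Fin 4 → ℝ) × (Fin 4 → ℝ) => d2 v z.1) (x, e) :=
  ContinuousAt.comp (x := (x, e)) (f := Prod.fst) (contDiffAt_d2 hv).continuousAt continuousAt_fst

theorem continuousAt_starForm₁ (hv : ContDiffAt ℝ 4 v x) :
    ContinuousAt (fun z : (Fin 4 → ℝ) × (Fin 4 → ℝ) => starForm₁ v z.2 z.1) (x, e) := by
  refine (continuousAt_hermPart fun a b => continuousAt_d3 hv a b).sub
    (ContinuousAt.const_smul (ContinuousAt.rankOne ?_ ?_) (2 : ℝ))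
  · exact ContinuousAt.comp (x := (x, e)) (f := Prod.fst) (continuousAt_coords_fderiv hv)
      continuousAt_fst
  · exact continuousAt_pi.2 fun i => ((continuousAt_d2 hv).clm_apply
      continuousAt_snd).clm_apply continuousAt_const

theorem continuousAt_invDet (hv : ContDiffAt ℝ 4 v x) (h0 : hermDet (hermPart (d2 v x)) ≠ 0) :
    ContinuousAt (fun z : (Fin 4 → ℝ) × (Fin 4 → ℝ) => invDet v z.1) (x, e) := by
  refine ContinuousAt.inv₀ ?_ h0
  exact (Continuous.hermDet continuous_id).continuousAt.comp (continuousAt_hermPart fun a b =>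
    ((continuousAt_d2 hv).clm_apply continuousAt_const).clm_apply continuousAt_const)

theorem continuousAt_solErrVal (hv : ContDiffAt ℝ 4 v x)
    (h0 : hermDet (hermPart (d2 v x)) ≠ 0) :
    ContinuousAt (fun z : (Fin 4 → ℝ) × (Fin 4 → ℝ) => solErrVal lam v z.1 z.2) (x, e) :=
  (continuous_errVal lam).continuousAt.comp ((continuousAt_invDet hv h0).prodMk
    ((((continuousAt_d2 hv).clm_apply continuousAt_snd).clm_apply continuousAt_snd).prodMk
      ((ContinuousAt.comp (x := (x, e)) (f := Prod.fst) (continuousAt_coords_fderiv hv)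
        continuousAt_fst).prodMk
        ((ContinuousAt.comp (x := (x, e)) (f := Prod.fst) (continuousAt_starForm hv)
          continuousAt_fst).prodMk ((continuousAt_starForm₁ hv).prodMk continuousAt_snd)))))

theorem continuousAt_solErrGrad (hv : ContDiffAt ℝ 4 v x)
    (h0 : hermDet (hermPart (d2 v x)) ≠ 0) (g : Fin 4 → ℝ) :
    ContinuousAt (fun z : (Fin 4 → ℝ) × (Fin 4 → ℝ) => solErrGrad lam v z.1 z.2 g) (x, e) :=
  (continuous_errGrad lam g).continuousAt.comp ((continuousAt_invDet hv h0).prodMk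
    ((ContinuousAt.comp (x := (x, e)) (f := Prod.fst) (continuousAt_coords_fderiv hv)
      continuousAt_fst).prodMk
      ((ContinuousAt.comp (x := (x, e)) (f := Prod.fst) (continuousAt_starForm hv)
        continuousAt_fst).prodMk ((continuousAt_starForm₁ hv).prodMk continuousAt_snd))))

theorem isCompact_unit_vectors : IsCompact {e : Fin 4 → ℝ | e ⬝ᵥ e = 1} := by
  refine Metric.isCompact_of_isClosed_isBounded
    (isClosed_eq (by fun_prop) continuous_const) ?_
  refine (Metric.isBounded_closedBall (x := (0 : Fin 4 → ℝ)) (r := 1)).subset fun e he => ?_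
  rw [mem_closedBall_zero_iff, pi_norm_le_iff_of_nonneg zero_le_one]
  intro i
  have hle : e i * e i ≤ e ⬝ᵥ e :=
    Finset.single_le_sum (f := fun j => e j * e j) (fun j _ => mul_self_nonneg (e j))
      (Finset.mem_univ i)
  exact abs_le_one_iff_mul_self_le_one.2 (hle.trans_eq he)

theorem starTrace_sq (lam : ℝ) {b : Fin 4 → ℝ} (hb : hermDet b = lam) (u : Fin 4 → ℝ) :
    (b 0 + b 1) * starTrace lam b (fun ξ => (ξ ⬝ᵥ u) ^ 2) =
      b 0 * (lam * (u ⬝ᵥ u) + hermVec (hermCof b) u ⬝ᵥ hermVec (hermCof b) u) := by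
  rw [← hb]
  simp [starTrace, hermDet, dotProduct, hermVec, hermCof, cofDir, cplx, Fin.sum_univ_four,
    Pi.single_apply]
  ring

theorem starTrace_dot_self (lam : ℝ) {b : Fin 4 → ℝ} (hb : hermDet b = lam) :
    starTrace lam b (fun ξ => ξ ⬝ᵥ ξ) = 2 * b 0 * (b 0 + b 1) := by
  rw [← hb]
  simp [starTrace, hermDet, dotProduct, cofDir, cplx, Fin.sum_univ_four, Pi.single_apply]
  ring

theorem dotProduct_self_nonneg' (u : Fin 4 → ℝ) : 0 ≤ u ⬝ᵥ u :=
  Finset.sum_nonneg fun i _ => mul_self_nonneg (u i)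

theorem exists_bounds (hstar : StarEq lam v Ω) (hlam : 0 < lam)
    (hv : ∀ z ∈ Ω, ContDiffAt ℝ 4 v z) (hpos : ∀ z ∈ Ω, ∀ y, 0 ≤ d2 v z y y)
    {K : Set (Fin 4 → ℝ)} (hK : IsCompact K) (hKΩ : K ⊆ Ω) :
    ∃ θ > 0, ∃ C > 0, ∀ z ∈ K,
      (∀ u : Fin 4 → ℝ, θ * (u ⬝ᵥ u) ≤ starTrace lam (starForm v z) fun ξ => (ξ ⬝ᵥ u) ^ 2) ∧
      starTrace lam (starForm v z) (fun ξ => ξ ⬝ᵥ ξ) ≤ C ∧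
      ∀ e : Fin 4 → ℝ, e ⬝ᵥ e = 1 → |solErrVal lam v z e| ≤ C ∧
        ∀ i, |solErrGrad lam v z e (Pi.single i 1)| ≤ C := by
  have hge := fun z hz => hermDet_hermPart_ge (d2_symm (hv z hz)) (hpos z hz)
    (coords (fderiv ℝ v z)) hlam (hermDet_starForm hstar hz (hv z hz))
  have hS : ∀ i, ContinuousOn (fun z => starForm v z i) K := fun i z hz =>
    (continuousAt_pi.1 (continuousAt_starForm (hv z (hKΩ hz))) i).continuousWithinAt
  have hb0 : ∀ z ∈ K, 0 < starForm v z 0 := fun z hz => (hge z (hKΩ hz)).2.1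
  have hs0 : ∀ z ∈ K, 0 < starForm v z 0 + starForm v z 1 := fun z hz =>
    add_pos (hb0 z hz) (hge z (hKΩ hz)).2.2
  have hU := hK.prod isCompact_unit_vectors
  obtain ⟨C₁, hC₁⟩ := hU.exists_bound_of_continuousOn
    (f := fun z : (Fin 4 → ℝ) × (Fin 4 → ℝ) => solErrVal lam v z.1 z.2) fun z hz =>
      (continuousAt_solErrVal (hv _ (hKΩ hz.1))
        (hlam.trans_le (hge _ (hKΩ hz.1)).1).ne').continuousWithinAt
  choose C₂ hC₂ using fun i : Fin 4 => hU.exists_bound_of_continuousOn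
    (f := fun z : (Fin 4 → ℝ) × (Fin 4 → ℝ) => solErrGrad lam v z.1 z.2 (Pi.single i 1))
      fun z hz => (continuousAt_solErrGrad (hv _ (hKΩ hz.1))
        (hlam.trans_le (hge _ (hKΩ hz.1)).1).ne' _).continuousWithinAt
  obtain ⟨C₃, hC₃⟩ := hK.exists_bound_of_continuousOn
    (f := fun z => 2 * starForm v z 0 * (starForm v z 0 + starForm v z 1))
    ((continuousOn_const.mul (hS 0)).mul ((hS 0).add (hS 1)))
  obtain ⟨C₄, hC₄⟩ := hK.exists_bound_of_continuousOn
    (f := fun z => (starForm v z 0 + starForm v z 1) / (starForm v z 0 * lam))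
    (((hS 0).add (hS 1)).div ((hS 0).mul continuousOn_const)
      fun z hz => (mul_pos (hb0 z hz) hlam).ne')
  refine ⟨(|C₄| + 1)⁻¹, by positivity, |C₁| + |C₃| + ∑ i, |C₂ i| + 1, by positivity,
    fun z hz => ⟨fun u => ?_, ?_, fun e he => ⟨?_, fun i => ?_⟩⟩⟩
  · have hC := (le_abs_self _).trans ((hC₄ z hz).trans (le_abs_self C₄))
    rw [div_le_iff₀ (mul_pos (hb0 z hz) hlam)] at hC
    have hsq := starTrace_sq lam (hermDet_starForm hstar (hKΩ hz) (hv z (hKΩ hz))) u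
    rw [inv_mul_le_iff₀ (by positivity)]
    have hu := dotProduct_self_nonneg' u
    have hw := mul_nonneg (hb0 z hz).le
      (dotProduct_self_nonneg' (hermVec (hermCof (starForm v z)) u))
    have hT : 0 ≤ starTrace lam (starForm v z) fun ξ => (ξ ⬝ᵥ u) ^ 2 := by
      refine nonneg_of_mul_nonneg_right (hsq ▸ ?_) (hs0 z hz)
      have := mul_nonneg (hb0 z hz).le (mul_nonneg hlam.le hu)
      linarith
    refine le_of_mul_le_mul_left ?_ (mul_pos (hb0 z hz) hlam)
    have h1 := mul_le_mul_of_nonneg_right hC hT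
    have h2 := mul_nonneg (mul_pos (hb0 z hz) hlam).le hT
    linarith
  · rw [starTrace_dot_self lam (hermDet_starForm hstar (hKΩ hz) (hv z (hKΩ hz)))]
    have hC := (le_abs_self _).trans ((hC₃ z hz).trans (le_abs_self C₃))
    have : 0 ≤ ∑ i, |C₂ i| := by positivity
    linarith [abs_nonneg C₁]
  · have hC := (hC₁ (z, e) ⟨hz, he⟩).trans (le_abs_self C₁)
    have : 0 ≤ ∑ i, |C₂ i| := by positivity
    rw [Real.norm_eq_abs] at hC
    linarith [abs_nonneg C₃]
  · have hC := (hC₂ i (z, e) ⟨hz, he⟩).trans (le_abs_self (C₂ i))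
    have : |C₂ i| ≤ ∑ i, |C₂ i| :=
      Finset.single_le_sum (f := fun j => |C₂ j|) (fun j _ => abs_nonneg _) (Finset.mem_univ i)
    rw [Real.norm_eq_abs] at hC
    linarith [abs_nonneg C₃, abs_nonneg C₁]

end Bounds

section Barrier

/-- The barrier function centred at `y₀`. -/
noncomputable def barrier (κ ε m : ℝ) (y₀ z : Fin 4 → ℝ) : ℝ :=
  ε * Real.exp (-κ * ((z - y₀) ⬝ᵥ (z - y₀))) - m

theorem contDiff_barrier (κ ε m : ℝ) (y₀ : Fin 4 → ℝ) : ContDiff ℝ 4 (barrier κ ε m y₀) := by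
  unfold barrier dotProduct
  fun_prop

theorem hasDerivAt_dist_line (x u ξ : Fin 4 → ℝ) (t : ℝ) :
    HasDerivAt (fun s : ℝ => (x + s • ξ - u) ⬝ᵥ (x + s • ξ - u))
      (2 * (ξ ⬝ᵥ (x + t • ξ - u))) t := by
  have h : ∀ i, HasDerivAt (fun s : ℝ => x i + s * ξ i - u i) (ξ i) t := fun i => by
    simpa using (((hasDerivAt_id t).mul_const (ξ i)).const_add (x i)).sub_const (u i)
  simp only [dotProduct, Fin.sum_univ_four, Pi.sub_apply, Pi.add_apply, Pi.smul_apply, smul_eq_mul]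
  refine ((((h 0).mul (h 0)).add ((h 1).mul (h 1))).add ((h 2).mul (h 2))).add
    ((h 3).mul (h 3)) |>.congr_deriv ?_
  ring

theorem hasDerivAt_barrier_line (κ ε m : ℝ) (y₀ x ξ : Fin 4 → ℝ) (t : ℝ) :
    HasDerivAt (fun s : ℝ => barrier κ ε m y₀ (x + s • ξ))
      (-2 * κ * ε * Real.exp (-κ * ((x + t • ξ - y₀) ⬝ᵥ (x + t • ξ - y₀))) *
        (ξ ⬝ᵥ (x + t • ξ - y₀))) t := by
  refine ((((hasDerivAt_dist_line x y₀ ξ t).const_mul (-κ)).exp.const_mul ε).sub_const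
    m).congr_deriv ?_
  ring

theorem fderiv_barrier (κ ε m : ℝ) (y₀ x ξ : Fin 4 → ℝ) :
    fderiv ℝ (barrier κ ε m y₀) x ξ =
      -2 * κ * ε * Real.exp (-κ * ((x - y₀) ⬝ᵥ (x - y₀))) * (ξ ⬝ᵥ (x - y₀)) := by
  have hd : DifferentiableAt ℝ (barrier κ ε m y₀) (x + (0 : ℝ) • ξ) :=
    (contDiff_barrier κ ε m y₀).contDiffAt.differentiableAt (by norm_num)
  simpa using (hasDerivAt_line hd.hasFDerivAt).unique (hasDerivAt_barrier_line κ ε m y₀ x ξ 0)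

theorem d2_barrier (κ ε m : ℝ) (y₀ x ξ : Fin 4 → ℝ) :
    d2 (barrier κ ε m y₀) x ξ ξ = ε * Real.exp (-κ * ((x - y₀) ⬝ᵥ (x - y₀))) *
      (4 * κ ^ 2 * (ξ ⬝ᵥ (x - y₀)) ^ 2 - 2 * κ * (ξ ⬝ᵥ ξ)) := by
  have h1 := hasDerivAt_fderiv_line (x := x) (ξ := ξ) (t := 0)
    (contDiff_barrier κ ε m y₀).contDiffAt ξ
  simp only [fderiv_barrier] at h1
  have hlin : HasDerivAt (fun s : ℝ => ξ ⬝ᵥ (x + s • ξ - y₀)) (ξ ⬝ᵥ ξ) 0 := by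
    have : (fun s : ℝ => ξ ⬝ᵥ (x + s • ξ - y₀)) = fun s => ξ ⬝ᵥ (x - y₀) + s * (ξ ⬝ᵥ ξ) := by
      funext s
      simp only [dotProduct_sub, dotProduct_add, dotProduct_smul, smul_eq_mul]
      ring
    rw [this]
    simpa using ((hasDerivAt_id (0 : ℝ)).mul_const (ξ ⬝ᵥ ξ)).const_add (ξ ⬝ᵥ (x - y₀))
  have h2 := (((hasDerivAt_dist_line x y₀ ξ 0).const_mul (-κ)).exp.const_mul (-2 * κ * ε)).mul hlin
  have := h1.unique h2
  simp only [zero_smul, add_zero] at this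
  rw [this]
  ring

theorem starTrace_d2_barrier (lam κ ε m : ℝ) (y₀ x b : Fin 4 → ℝ) :
    starTrace lam b (fun ξ => d2 (barrier κ ε m y₀) x ξ ξ) =
      ε * Real.exp (-κ * ((x - y₀) ⬝ᵥ (x - y₀))) *
        (4 * κ ^ 2 * starTrace lam b (fun ξ => (ξ ⬝ᵥ (x - y₀)) ^ 2) -
          2 * κ * starTrace lam b fun ξ => ξ ⬝ᵥ ξ) := by
  simp only [starTrace, d2_barrier]
  ring

/-- If the exponent is large, a barrier cannot touch the eigenvalues of the Hessian from below. -/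
theorem exists_barrier_not_touch {v : (Fin 4 → ℝ) → ℝ} {Ω : Set (Fin 4 → ℝ)} {lam : ℝ}
    (hΩ : IsOpen Ω) (hstar : StarEq lam v Ω) (hlam : 0 < lam)
    (hv : ∀ z ∈ Ω, ContDiffAt ℝ 4 v z) (hpos : ∀ z ∈ Ω, ∀ y, 0 ≤ d2 v z y y)
    {K : Set (Fin 4 → ℝ)} (hK : IsCompact K) (hKΩ : K ⊆ Ω) {ρ R : ℝ} (hρ : 0 < ρ) (hR : 0 ≤ R) :
    ∃ κ > 0, ∀ x ∈ K, ∀ y₀, ρ ≤ (x - y₀) ⬝ᵥ (x - y₀) → (x - y₀) ⬝ᵥ (x - y₀) ≤ R ^ 2 →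
      ∀ ε > 0, ∀ m ≥ 0, ∀ n e : Fin 4 → ℝ, n = 0 ∨ n ⬝ᵥ n = 1 → d2 v x n n = 0 → e ⬝ᵥ e = 1 →
        n ⬝ᵥ e = 0 → d2 v x e e = barrier κ ε m y₀ x →
        ¬ ∀ᶠ z in 𝓝 x, ∀ w, w ⬝ᵥ n = 0 →
          0 ≤ (d2 v z n n - barrier κ ε m y₀ z) * (w ⬝ᵥ w) + d2 v z w w := by
  obtain ⟨θ, hθ, C, hC, hbd⟩ := exists_bounds hstar hlam hv hpos hK hKΩ
  set M : ℝ := 3 * C + 8 * C * R with hM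
  have hM0 : 0 < M := by positivity
  refine ⟨M / (4 * θ * ρ) + 1, by positivity, ?_⟩
  set κ : ℝ := M / (4 * θ * ρ) + 1 with hκdef
  have hκ : 0 < κ := by positivity
  intro x hx y₀ hxρ hxR ε hε m hm n e hn hnull he hne hval htouch
  obtain ⟨hT, hS, hE⟩ := hbd x hx
  obtain ⟨hEv, hEg⟩ := hE e he
  have key := starTrace_le_of_touch hΩ hstar hlam (hKΩ hx) (hv x (hKΩ hx)) hpos
    (contDiff_barrier κ ε m y₀).contDiffAt hn hnull he hne hval htouch
  rw [starTrace_d2_barrier, solErrGrad_eq_sum] at key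
  set u := x - y₀ with hu
  set P := ε * Real.exp (-κ * (u ⬝ᵥ u)) with hP
  have hPpos : 0 < P := by positivity
  have hh0 : 0 ≤ barrier κ ε m y₀ x := hval ▸ hpos x (hKΩ hx) e
  have hh1 : barrier κ ε m y₀ x ≤ P := by
    rw [barrier]
    linarith
  have hui : ∀ i, |u i| ≤ R := fun i => by
    refine abs_le_of_sq_le_sq (le_trans ?_ hxR) hR
    rw [sq]
    exact Finset.single_le_sum (f := fun j => u j * u j) (fun j _ => mul_self_nonneg (u j))
      (Finset.mem_univ i)
  have hval' : barrier κ ε m y₀ x * solErrVal lam v x e ≤ P * C :=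
    (mul_le_mul_of_nonneg_left ((le_abs_self _).trans hEv) hh0).trans
      (mul_le_mul_of_nonneg_right hh1 hC.le)
  have hgrad : ∀ i, coords (fderiv ℝ (barrier κ ε m y₀) x) i *
      solErrGrad lam v x e (Pi.single i 1) ≤ 2 * κ * P * R * C := fun i => by
    refine (le_abs_self _).trans ?_
    rw [abs_mul]
    refine mul_le_mul ?_ (hEg i) (abs_nonneg _) (by positivity)
    rw [coords, fderiv_barrier, single_one_dotProduct, abs_mul]
    refine mul_le_mul (le_of_eq ?_) (hui i) (abs_nonneg _) (by positivity)
    rw [abs_of_nonpos (by rw [← hu]; nlinarith [mul_pos hκ hPpos]), hP]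
    ring
  have hsum : ∑ i, coords (fderiv ℝ (barrier κ ε m y₀) x) i *
      solErrGrad lam v x e (Pi.single i 1) ≤ ∑ _i : Fin 4, 2 * κ * P * R * C :=
    Finset.sum_le_sum fun i _ => hgrad i
  simp only [Finset.sum_const, Finset.card_univ, Fintype.card_fin, nsmul_eq_mul] at hsum
  have hTlow : θ * ρ ≤ starTrace lam (starForm v x) fun ξ => (ξ ⬝ᵥ u) ^ 2 :=
    (mul_le_mul_of_nonneg_left hxρ hθ.le).trans (hT u)
  have hlow : P * (4 * κ ^ 2 * (θ * ρ) - 2 * κ * C) ≤ P * C + 4 * (2 * κ * P * R * C) := by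
    refine le_trans (mul_le_mul_of_nonneg_left ?_ hPpos.le) (key.trans (add_le_add hval' ?_))
    · have := mul_le_mul_of_nonneg_left hTlow (by positivity : 0 ≤ 4 * κ ^ 2)
      have := mul_le_mul_of_nonneg_left hS (by positivity : 0 ≤ 2 * κ)
      linarith
    · simpa using hsum
  have hfinal : 4 * κ ^ 2 * (θ * ρ) - 2 * κ * C ≤ C + 8 * κ * R * C := by
    refine le_of_mul_le_mul_left (hlow.trans_eq ?_) hPpos
    ring
  have h1 : M < κ * (4 * θ * ρ) := by
    rw [← div_lt_iff₀ (by positivity)]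
    linarith
  have h2 : 1 ≤ κ := by
    have : 0 ≤ M / (4 * θ * ρ) := by positivity
    linarith
  nlinarith [mul_lt_mul_of_pos_left h1 hκ, mul_le_mul_of_nonneg_right h2 hC.le]

end Barrier

section Propagation

/-- The sum of the values of the Hessian on a pair of vectors. -/
noncomputable def pairVal (v : (Fin 4 → ℝ) → ℝ) (x : Fin 4 → ℝ)
    (θ : (Fin 4 → ℝ) × (Fin 4 → ℝ)) : ℝ :=
  d2 v x θ.1 θ.1 + d2 v x θ.2 θ.2

/-- The points of `Ω` where the Hessian vanishes on some pair in `Θ`. -/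
def nullSet (v : (Fin 4 → ℝ) → ℝ) (Ω : Set (Fin 4 → ℝ)) (Θ : Set ((Fin 4 → ℝ) × (Fin 4 → ℝ))) :
    Set (Fin 4 → ℝ) :=
  {x | x ∈ Ω ∧ ∃ θ ∈ Θ, pairVal v x θ = 0}

/-- Any pair in `Θ` can be improved to a pair whose first vector is null and whose second
vector may vary freely in the orthogonal complement of the first. -/
def Reducible (v : (Fin 4 → ℝ) → ℝ) (Ω : Set (Fin 4 → ℝ))
    (Θ : Set ((Fin 4 → ℝ) × (Fin 4 → ℝ))) : Prop :=
  ∀ x ∈ Ω, ∀ θ ∈ Θ, ∃ n e : Fin 4 → ℝ, (n, e) ∈ Θ ∧ pairVal v x (n, e) ≤ pairVal v x θ ∧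
    d2 v x n n = 0 ∧ (n = 0 ∨ n ⬝ᵥ n = 1) ∧ e ⬝ᵥ e = 1 ∧ n ⬝ᵥ e = 0 ∧
    ∀ w : Fin 4 → ℝ, w ⬝ᵥ w = 1 → w ⬝ᵥ n = 0 → (n, w) ∈ Θ

variable {v : (Fin 4 → ℝ) → ℝ} {Ω : Set (Fin 4 → ℝ)} {lam : ℝ}
  {Θ : Set ((Fin 4 → ℝ) × (Fin 4 → ℝ))}

theorem continuousAt_pairVal {x : Fin 4 → ℝ} (hv : ContDiffAt ℝ 4 v x)
    (θ : (Fin 4 → ℝ) × (Fin 4 → ℝ)) :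
    ContinuousAt (fun z : (Fin 4 → ℝ) × (Fin 4 → ℝ) × (Fin 4 → ℝ) => pairVal v z.1 z.2) (x, θ) := by
  have h : ContinuousAt (fun z : (Fin 4 → ℝ) × (Fin 4 → ℝ) × (Fin 4 → ℝ) => d2 v z.1) (x, θ) :=
    ContinuousAt.comp (x := (x, θ)) (f := Prod.fst) (contDiffAt_d2 hv).continuousAt continuousAt_fst
  have h1 : ContinuousAt (fun z : (Fin 4 → ℝ) × (Fin 4 → ℝ) × (Fin 4 → ℝ) => z.2.1) (x, θ) := by
    fun_prop
  have h2 : ContinuousAt (fun z : (Fin 4 → ℝ) × (Fin 4 → ℝ) × (Fin 4 → ℝ) => z.2.2) (x, θ) := by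
    fun_prop
  exact ((h.clm_apply h1).clm_apply h1).add ((h.clm_apply h2).clm_apply h2)

theorem continuousOn_pairVal (hv : ∀ z ∈ Ω, ContDiffAt ℝ 4 v z) {K : Set (Fin 4 → ℝ)}
    (hKΩ : K ⊆ Ω) :
    ContinuousOn (fun z : (Fin 4 → ℝ) × (Fin 4 → ℝ) × (Fin 4 → ℝ) => pairVal v z.1 z.2)
      (K ×ˢ Θ) := fun z hz => (continuousAt_pairVal (hv _ (hKΩ hz.1)) z.2).continuousWithinAt

theorem isCompact_nullSet_inter (hv : ∀ z ∈ Ω, ContDiffAt ℝ 4 v z) (hΘ : IsCompact Θ)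
    {K : Set (Fin 4 → ℝ)} (hK : IsCompact K) (hKΩ : K ⊆ Ω) : IsCompact (nullSet v Ω Θ ∩ K) := by
  have hcl : IsClosed ((K ×ˢ Θ) ∩ (fun z : (Fin 4 → ℝ) × (Fin 4 → ℝ) × (Fin 4 → ℝ) =>
      pairVal v z.1 z.2) ⁻¹' {0}) :=
    (continuousOn_pairVal hv hKΩ).preimage_isClosed_of_isClosed (hK.prod hΘ).isClosed
      isClosed_singleton
  have hc := ((hK.prod hΘ).of_isClosed_subset hcl inter_subset_left).image continuous_fst
  convert hc using 1
  ext z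
  constructor
  · rintro ⟨⟨-, θ, hθ, h0⟩, hz⟩
    exact ⟨(z, θ), ⟨⟨hz, hθ⟩, h0⟩, rfl⟩
  · rintro ⟨⟨z, θ⟩, ⟨⟨hz, hθ⟩, h0⟩, rfl⟩
    exact ⟨⟨hKΩ hz, θ, hθ, h0⟩, hz⟩

theorem isCompact_dist_le (y : Fin 4 → ℝ) (r : ℝ) :
    IsCompact {z : Fin 4 → ℝ | (z - y) ⬝ᵥ (z - y) ≤ r ^ 2} := by
  refine Metric.isCompact_of_isClosed_isBounded
    (isClosed_le (by fun_prop) continuous_const) ?_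
  refine (Metric.isBounded_closedBall (x := y) (r := |r|)).subset fun z hz => ?_
  rw [mem_closedBall_iff_norm, pi_norm_le_iff_of_nonneg (abs_nonneg r)]
  intro i
  have hle : (z - y) i * (z - y) i ≤ (z - y) ⬝ᵥ (z - y) :=
    Finset.single_le_sum (f := fun j => (z - y) j * (z - y) j)
      (fun j _ => mul_self_nonneg ((z - y) j)) (Finset.mem_univ i)
  exact sq_le_sq.1 ((sq ((z - y) i)).trans_le (hle.trans hz))

/-- Hopf's lemma for the null set. -/
theorem not_mem_nullSet_of_dist_eq (hΩ : IsOpen Ω) (hstar : StarEq lam v Ω) (hlam : 0 < lam)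
    (hv : ∀ z ∈ Ω, ContDiffAt ℝ 4 v z) (hpos : ∀ z ∈ Ω, ∀ y, 0 ≤ d2 v z y y)
    (hΘ : IsCompact Θ) (hred : Reducible v Ω Θ) {y₀ : Fin 4 → ℝ} {R : ℝ} (hR : 0 < R)
    (hball : ∀ z, (z - y₀) ⬝ᵥ (z - y₀) ≤ R ^ 2 → z ∈ Ω)
    (hpair : ∀ z, (z - y₀) ⬝ᵥ (z - y₀) < R ^ 2 → ∀ θ ∈ Θ, 0 < pairVal v z θ)
    {x₀ : Fin 4 → ℝ} (hx₀ : (x₀ - y₀) ⬝ᵥ (x₀ - y₀) = R ^ 2) : x₀ ∉ nullSet v Ω Θ := by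
  rintro ⟨hx₀Ω, θ₀, hθ₀, hzero⟩
  have hF : ∀ z ∈ Ω, ∀ θ, 0 ≤ pairVal v z θ := fun z hz θ => add_nonneg (hpos z hz _) (hpos z hz _)
  have hqc : Continuous fun z : Fin 4 → ℝ => (z - y₀) ⬝ᵥ (z - y₀) := by fun_prop
  set K : Set (Fin 4 → ℝ) := {z | R ^ 2 / 4 ≤ (z - y₀) ⬝ᵥ (z - y₀)} ∩
    {z | (z - y₀) ⬝ᵥ (z - y₀) ≤ R ^ 2} with hKdef
  have hK : IsCompact K :=
    (isCompact_dist_le y₀ R).inter_left (isClosed_le continuous_const hqc)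
  have hKΩ : K ⊆ Ω := fun z hz => hball z hz.2
  obtain ⟨κ, hκ, hnot⟩ := exists_barrier_not_touch hΩ hstar hlam hv hpos hK hKΩ
    (ρ := R ^ 2 / 4) (by positivity) hR.le
  obtain ⟨ε, hε, hεF⟩ : ∃ ε > 0, ∀ z, (z - y₀) ⬝ᵥ (z - y₀) = R ^ 2 / 4 → ∀ θ ∈ Θ,
      ε ≤ pairVal v z θ := by
    set S : Set (Fin 4 → ℝ) := K ∩ {z | (z - y₀) ⬝ᵥ (z - y₀) = R ^ 2 / 4}
    have hS : IsCompact S := hK.inter_right (isClosed_eq hqc continuous_const)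
    have hmem : ∀ z, (z - y₀) ⬝ᵥ (z - y₀) = R ^ 2 / 4 → z ∈ S := fun z hz =>
      ⟨⟨hz.ge, hz.le.trans (by nlinarith)⟩, hz⟩
    rcases (S ×ˢ Θ).eq_empty_or_nonempty with h | h
    · exact ⟨1, one_pos, fun z hz θ hθ => (h.subset (mk_mem_prod (hmem z hz) hθ)).elim⟩
    · obtain ⟨⟨z₁, θ₁⟩, h₁, hmin⟩ := (hS.prod hΘ).exists_isMinOn h
        (continuousOn_pairVal hv (inter_subset_left.trans hKΩ))
      have hz₁ : (z₁ - y₀) ⬝ᵥ (z₁ - y₀) = R ^ 2 / 4 := h₁.1.2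
      exact ⟨pairVal v z₁ θ₁, hpair z₁ (by rw [hz₁]; nlinarith [pow_pos hR 2]) θ₁ h₁.2,
        fun z hz θ hθ => hmin (mk_mem_prod (hmem z hz) hθ)⟩
  set m₀ := ε * Real.exp (-κ * R ^ 2) with hm₀
  have hm₀pos : 0 < m₀ := by positivity
  set h := barrier κ ε m₀ y₀ with hh
  have hhc : Continuous h := (contDiff_barrier κ ε m₀ y₀).continuous
  have hbar : ∀ z ∈ K, ∀ θ ∈ Θ, h z ≤ pairVal v z θ := by
    obtain ⟨⟨x₁, θ₁⟩, h₁, hmin⟩ := (hK.prod hΘ).exists_isMinOn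
      (f := fun z : (Fin 4 → ℝ) × (Fin 4 → ℝ) × (Fin 4 → ℝ) => pairVal v z.1 z.2 - h z.1)
      ⟨(x₀, θ₀), ⟨⟨by rw [mem_ofPred_eq, hx₀]; nlinarith, hx₀.le⟩, hθ₀⟩⟩
      ((continuousOn_pairVal hv hKΩ).sub (hhc.comp continuous_fst).continuousOn)
    have hle : ∀ z ∈ K, ∀ θ ∈ Θ, pairVal v x₁ θ₁ - h x₁ ≤ pairVal v z θ - h z :=
      fun z hz θ hθ => hmin (mk_mem_prod hz hθ)
    have hx₁ : x₁ ∈ K := h₁.1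
    have hθ₁ : θ₁ ∈ Θ := h₁.2
    by_contra! hcon
    obtain ⟨z, hz, θ, hθ, hlt⟩ := hcon
    have hneg : pairVal v x₁ θ₁ < h x₁ := by linarith [hle z hz θ hθ]
    have hlow : R ^ 2 / 4 < (x₁ - y₀) ⬝ᵥ (x₁ - y₀) := by
      refine lt_of_le_of_ne hx₁.1 fun heq => ?_
      have h2 := hεF x₁ heq.symm θ₁ hθ₁
      have h3 : Real.exp (-κ * ((x₁ - y₀) ⬝ᵥ (x₁ - y₀))) ≤ 1 := by
        rw [Real.exp_le_one_iff, ← heq]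
        nlinarith [mul_pos hκ (pow_pos hR 2)]
      have h4 : h x₁ ≤ ε := by
        rw [hh, barrier]
        nlinarith
      linarith
    have hup : (x₁ - y₀) ⬝ᵥ (x₁ - y₀) < R ^ 2 := by
      refine lt_of_le_of_ne hx₁.2 fun heq => ?_
      have h2 : h x₁ = 0 := by rw [hh, barrier, heq, hm₀, sub_self]
      linarith [hF x₁ (hKΩ hx₁) θ₁]
    obtain ⟨n, e, hne, hFle, hnull, hn, he, horth, hfree⟩ := hred x₁ (hKΩ hx₁) θ₁ hθ₁
    have hFe : pairVal v x₁ (n, e) = d2 v x₁ e e := by simp [pairVal, hnull]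
    have hFeq : d2 v x₁ e e = pairVal v x₁ θ₁ := by
      have := hle x₁ hx₁ (n, e) hne
      rw [← hFe]
      linarith
    set m := h x₁ - pairVal v x₁ θ₁ with hm
    have hbm : ∀ z, barrier κ ε (m₀ + m) y₀ z = h z - m := fun z => by
      simp only [hh, barrier]
      ring
    refine hnot x₁ hx₁ y₀ hx₁.1 hx₁.2 ε hε (m₀ + m) (by linarith) n e hn hnull he horth
      (by rw [hbm, hFeq]; ring) ?_
    filter_upwards [hqc.continuousAt.eventually_mem (Ioo_mem_nhds hlow hup)] with z hz w hw
    have hzK : z ∈ K := ⟨hz.1.le, hz.2.le⟩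
    rcases eq_or_ne w 0 with rfl | hw0
    · simp
    · have hww : 0 < w ⬝ᵥ w := by
        refine lt_of_le_of_ne (dotProduct_self_nonneg' w) fun h0 => hw0 ?_
        exact dotProduct_self_eq_zero.1 h0.symm
      set c := (√(w ⬝ᵥ w))⁻¹ with hc
      have hcc : c * c * (w ⬝ᵥ w) = 1 := by
        rw [hc, ← mul_inv, Real.mul_self_sqrt hww.le, inv_mul_cancel₀ hww.ne']
      have hcw := hle z hzK (n, c • w) (hfree _ (by
        rw [smul_dotProduct, dotProduct_smul, smul_eq_mul, smul_eq_mul, ← mul_assoc, hcc]) (by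
        rw [smul_dotProduct, hw, smul_zero]))
      have hval : pairVal v z (n, c • w) = d2 v z n n + c * (c * d2 v z w w) := by simp [pairVal]
      rw [hval] at hcw
      rw [hbm]
      have h5 := mul_nonneg hww.le (sub_nonneg.2 hcw)
      have h6 : (w ⬝ᵥ w) * (c * (c * d2 v z w w)) = d2 v z w w := by
        linear_combination d2 v z w w * hcc
      have h7 : (d2 v z n n - (h z - m)) * (w ⬝ᵥ w) + d2 v z w w = (w ⬝ᵥ w) *
          (d2 v z n n + c * (c * d2 v z w w) - h z - (pairVal v x₁ θ₁ - h x₁)) := by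
        linear_combination -h6 + (w ⬝ᵥ w) * hm
      rw [h7]
      exact h5
  have hφ : HasDerivAt (fun t : ℝ => pairVal v (x₀ + t • (y₀ - x₀)) θ₀)
      (d3 v x₀ (y₀ - x₀) θ₀.1 θ₀.1 + d3 v x₀ (y₀ - x₀) θ₀.2 θ₀.2) 0 := by
    have hv0 : ContDiffAt ℝ 4 v (x₀ + (0 : ℝ) • (y₀ - x₀)) := by simpa using hv x₀ hx₀Ω
    exact ((hasDerivAt_d2_line hv0 θ₀.1 θ₀.1).add (hasDerivAt_d2_line hv0 θ₀.2 θ₀.2)).congr_deriv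
      (by simp)
  have hφmin : IsLocalMin (fun t : ℝ => pairVal v (x₀ + t • (y₀ - x₀)) θ₀) 0 := by
    filter_upwards [(tendsto_line x₀ (y₀ - x₀)).eventually (hΩ.mem_nhds hx₀Ω)] with t ht
    simpa [hzero] using hF _ ht θ₀
  have hφ0 := hφmin.hasDerivAt_eq_zero hφ
  rw [hφ0] at hφ
  have hdiff := (hφ.sub (hasDerivAt_barrier_line κ ε m₀ y₀ x₀ (y₀ - x₀) 0)).tendsto_slope_zero_right
  have hsign := ge_of_tendsto hdiff (b := 0) (by
    filter_upwards [Ioo_mem_nhdsGT (show (0 : ℝ) < 1 / 2 by norm_num)] with t ht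
    have hdist : (x₀ + t • (y₀ - x₀) - y₀) ⬝ᵥ (x₀ + t • (y₀ - x₀) - y₀) = (1 - t) ^ 2 * R ^ 2 := by
      have : x₀ + t • (y₀ - x₀) - y₀ = (1 - t) • (x₀ - y₀) := by
        module
      rw [this, smul_dotProduct, dotProduct_smul, hx₀, smul_eq_mul, smul_eq_mul]
      ring
    have hmem : x₀ + t • (y₀ - x₀) ∈ K := by
      have ht1 : 1 / 4 ≤ (1 - t) ^ 2 := by nlinarith [ht.2]
      have ht2 : (1 - t) ^ 2 ≤ 1 := by nlinarith [ht.1, ht.2]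
      refine ⟨?_, ?_⟩ <;> rw [mem_ofPred_eq, hdist] <;> nlinarith [pow_pos hR 2]
    have h0 : barrier κ ε m₀ y₀ x₀ = 0 := by rw [barrier, hx₀, hm₀, sub_self]
    have := hbar _ hmem θ₀ hθ₀
    simp only [Pi.sub_apply, zero_add, zero_smul, add_zero, hzero, h0, sub_zero, smul_eq_mul]
    exact mul_nonneg (inv_nonneg.2 ht.1.le) (sub_nonneg.2 this))
  have hdot : (y₀ - x₀) ⬝ᵥ (x₀ - y₀) = -R ^ 2 := by
    rw [← neg_sub x₀ y₀, neg_dotProduct, hx₀]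
  simp only [zero_smul, add_zero, hdot] at hsign
  have : 0 < κ * ε * Real.exp (-κ * ((x₀ - y₀) ⬝ᵥ (x₀ - y₀))) * R ^ 2 := by positivity
  linarith

theorem norm_sq_le_dot (u : Fin 4 → ℝ) : ‖u‖ ^ 2 ≤ u ⬝ᵥ u := by
  have h : ‖u‖ ≤ √(u ⬝ᵥ u) := (pi_norm_le_iff_of_nonneg (Real.sqrt_nonneg _)).2 fun i => by
    refine Real.abs_le_sqrt ?_
    rw [sq]
    exact Finset.single_le_sum (f := fun j => u j * u j) (fun j _ => mul_self_nonneg (u j))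
      (Finset.mem_univ i)
  calc ‖u‖ ^ 2 ≤ √(u ⬝ᵥ u) ^ 2 := by gcongr
    _ = u ⬝ᵥ u := Real.sq_sqrt (dotProduct_self_nonneg' u)

theorem dot_le_norm_sq (u : Fin 4 → ℝ) : u ⬝ᵥ u ≤ 4 * ‖u‖ ^ 2 := by
  have h : ∑ i, u i * u i ≤ ∑ _i : Fin 4, ‖u‖ ^ 2 := Finset.sum_le_sum fun i _ => by
    rw [← abs_mul_abs_self, sq]
    exact mul_self_le_mul_self (abs_nonneg _) (norm_le_pi_norm u i)
  simpa [dotProduct] using h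

theorem isOpen_nullSet (hΩ : IsOpen Ω) (hstar : StarEq lam v Ω) (hlam : 0 < lam)
    (hv : ∀ z ∈ Ω, ContDiffAt ℝ 4 v z) (hpos : ∀ z ∈ Ω, ∀ y, 0 ≤ d2 v z y y)
    (hΘ : IsCompact Θ) (hred : Reducible v Ω Θ) : IsOpen (nullSet v Ω Θ) := by
  rw [Metric.isOpen_iff]
  intro a ha
  obtain ⟨r, hr, hrΩ⟩ := Metric.nhds_basis_closedBall.mem_iff.1 (hΩ.mem_nhds ha.1)
  refine ⟨r / 3, by positivity, fun y hy => ?_⟩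
  by_contra hyZ
  obtain ⟨x₀, hx₀, hmin⟩ := (isCompact_nullSet_inter hv hΘ
    (isCompact_closedBall a r) hrΩ).exists_isMinOn ⟨a, ha, Metric.mem_closedBall_self hr.le⟩
      (f := fun z => (z - y) ⬝ᵥ (z - y)) (by fun_prop)
  have hle : ∀ z ∈ nullSet v Ω Θ, z ∈ Metric.closedBall a r →
      (x₀ - y) ⬝ᵥ (x₀ - y) ≤ (z - y) ⬝ᵥ (z - y) := fun z hz hz' => hmin ⟨hz, hz'⟩
  have hR : 0 < (x₀ - y) ⬝ᵥ (x₀ - y) := by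
    refine lt_of_le_of_ne (dotProduct_self_nonneg' _) fun h0 => hyZ ?_
    rw [← sub_eq_zero.1 (dotProduct_self_eq_zero.1 h0.symm)]
    exact hx₀.1
  have hRa : (x₀ - y) ⬝ᵥ (x₀ - y) ≤ (2 * (r / 3)) ^ 2 := by
    refine (hle a ha (Metric.mem_closedBall_self hr.le)).trans ((dot_le_norm_sq _).trans ?_)
    have : ‖a - y‖ ≤ r / 3 := by
      rw [← dist_eq_norm, dist_comm]
      exact (Metric.mem_ball.1 hy).le
    nlinarith [norm_nonneg (a - y)]
  have hmem : ∀ z, (z - y) ⬝ᵥ (z - y) ≤ (x₀ - y) ⬝ᵥ (x₀ - y) → z ∈ Metric.closedBall a r :=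
    fun z hz => by
      have h1 : ‖z - y‖ ≤ 2 * (r / 3) :=
        abs_le_of_sq_le_sq' ((norm_sq_le_dot _).trans (hz.trans hRa)) (by positivity) |>.2
      rw [Metric.mem_closedBall]
      rw [← dist_eq_norm] at h1
      linarith [dist_triangle z y a, Metric.mem_ball.1 hy]
  refine not_mem_nullSet_of_dist_eq hΩ hstar hlam hv hpos hΘ hred (y₀ := y)
    (R := √((x₀ - y) ⬝ᵥ (x₀ - y))) (Real.sqrt_pos.2 hR) ?_ ?_ (Real.sq_sqrt hR.le).symm hx₀.1
  · intro z hz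
    rw [Real.sq_sqrt hR.le] at hz
    exact hrΩ (hmem z hz)
  · intro z hz θ hθ
    rw [Real.sq_sqrt hR.le] at hz
    have hzb := hmem z hz.le
    refine lt_of_le_of_ne (add_nonneg (hpos z (hrΩ hzb) _) (hpos z (hrΩ hzb) _)) fun h0 => ?_
    exact hz.not_ge (hle z ⟨hrΩ hzb, θ, hθ, h0.symm⟩ hzb)

theorem nullSet_eq_of_nonempty (hΩ : IsOpen Ω) (hconn : IsConnected Ω) (hstar : StarEq lam v Ω)
    (hlam : 0 < lam) (hv : ∀ z ∈ Ω, ContDiffAt ℝ 4 v z) (hpos : ∀ z ∈ Ω, ∀ y, 0 ≤ d2 v z y y)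
    (hΘ : IsCompact Θ) (hred : Reducible v Ω Θ) (hne : (nullSet v Ω Θ).Nonempty) :
    nullSet v Ω Θ = Ω := by
  have hsub : nullSet v Ω Θ ⊆ Ω := fun z hz => hz.1
  refine hsub.antisymm (hconn.isPreconnected.subset_of_closure_inter_subset
    (isOpen_nullSet hΩ hstar hlam hv hpos hΘ hred) ?_ ?_)
  · rwa [inter_eq_right.2 hsub]
  · rintro x ⟨hx, hxΩ⟩
    obtain ⟨r, hr, hrΩ⟩ := Metric.nhds_basis_closedBall.mem_iff.1 (hΩ.mem_nhds hxΩ)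
    have hcl := (isCompact_nullSet_inter hv hΘ (isCompact_closedBall x r) hrΩ).isClosed
    have h1 := Metric.isOpen_ball.inter_closure ⟨Metric.mem_ball_self hr, hx⟩
    have h2 : Metric.ball x r ∩ nullSet v Ω Θ ⊆ nullSet v Ω Θ ∩ Metric.closedBall x r :=
      fun z hz => ⟨hz.2, Metric.ball_subset_closedBall hz.1⟩
    exact (hcl.closure_subset_iff.2 h2 h1).1

end Propagation

section Rank

variable {v : (Fin 4 → ℝ) → ℝ} {Ω : Set (Fin 4 → ℝ)} {lam : ℝ} {x : Fin 4 → ℝ}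

/-- Unit vectors, as pairs with vanishing first vector. -/
def unitPairs : Set ((Fin 4 → ℝ) × (Fin 4 → ℝ)) := {0} ×ˢ {e | e ⬝ᵥ e = 1}

/-- Orthonormal pairs. -/
def orthonormalPairs : Set ((Fin 4 → ℝ) × (Fin 4 → ℝ)) :=
  ({n | n ⬝ᵥ n = 1} ×ˢ {e | e ⬝ᵥ e = 1}) ∩ {θ | θ.1 ⬝ᵥ θ.2 = 0}

theorem isCompact_unitPairs : IsCompact unitPairs :=
  isCompact_singleton.prod isCompact_unit_vectors

theorem isCompact_orthonormalPairs : IsCompact orthonormalPairs :=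
  (isCompact_unit_vectors.prod isCompact_unit_vectors).inter_right
    (isClosed_eq (by fun_prop) continuous_const)

theorem mem_nullSet_unitPairs (hx : x ∈ Ω) :
    x ∈ nullSet v Ω unitPairs ↔ ∃ e : Fin 4 → ℝ, e ⬝ᵥ e = 1 ∧ d2 v x e e = 0 := by
  constructor
  · rintro ⟨-, ⟨n, e⟩, ⟨hn, he⟩, h0⟩
    obtain rfl : n = 0 := hn
    exact ⟨e, he, by simpa [pairVal] using h0⟩
  · rintro ⟨e, he, h0⟩
    exact ⟨hx, (0, e), ⟨rfl, he⟩, by simp [pairVal, h0]⟩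

theorem mem_nullSet_orthonormalPairs (hx : x ∈ Ω) (hpos : ∀ z ∈ Ω, ∀ y, 0 ≤ d2 v z y y) :
    x ∈ nullSet v Ω orthonormalPairs ↔ ∃ n e : Fin 4 → ℝ, n ⬝ᵥ n = 1 ∧ e ⬝ᵥ e = 1 ∧ n ⬝ᵥ e = 0 ∧
      d2 v x n n = 0 ∧ d2 v x e e = 0 := by
  constructor
  · rintro ⟨-, ⟨n, e⟩, ⟨⟨hn, he⟩, hne⟩, h0⟩
    have h := (add_eq_zero_iff_of_nonneg (hpos x hx n) (hpos x hx e)).1 h0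
    exact ⟨n, e, hn, he, hne, h.1, h.2⟩
  · rintro ⟨n, e, hn, he, hne, hn0, he0⟩
    exact ⟨hx, (n, e), ⟨⟨hn, he⟩, hne⟩, by simp [pairVal, hn0, he0]⟩

theorem exists_unit_smul {u : Fin 4 → ℝ} (hu : u ≠ 0) :
    ∃ c : ℝ, (c • u) ⬝ᵥ (c • u) = 1 ∧ c ^ 2 * (u ⬝ᵥ u) = 1 := by
  have hpos : 0 < u ⬝ᵥ u := lt_of_le_of_ne (dotProduct_self_nonneg' u) fun h =>
    hu (dotProduct_self_eq_zero.1 h.symm)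
  have h : (√(u ⬝ᵥ u))⁻¹ ^ 2 * (u ⬝ᵥ u) = 1 := by
    rw [inv_pow, Real.sq_sqrt hpos.le, inv_mul_cancel₀ hpos.ne']
  refine ⟨(√(u ⬝ᵥ u))⁻¹, ?_, h⟩
  rw [smul_dotProduct, dotProduct_smul, smul_eq_mul, smul_eq_mul, ← mul_assoc, ← sq, h]

theorem reducible_unitPairs : Reducible v Ω unitPairs := by
  rintro x - ⟨n, e⟩ ⟨hn, he⟩
  obtain rfl : n = 0 := hn
  exact ⟨0, e, ⟨rfl, he⟩, le_rfl, by simp, Or.inl rfl, he, by simp, fun w hw _ => ⟨rfl, hw⟩⟩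

theorem reducible_orthonormalPairs (hpos : ∀ z ∈ Ω, ∀ y, 0 ≤ d2 v z y y)
    (hΩ1 : nullSet v Ω unitPairs = Ω) :
    Reducible v Ω orthonormalPairs := by
  rintro x hx ⟨n, e⟩ ⟨⟨hn, he⟩, hne⟩
  replace hn : n ⬝ᵥ n = 1 := hn
  replace he : e ⬝ᵥ e = 1 := he
  replace hne : n ⬝ᵥ e = 0 := hne
  obtain ⟨m, hm, hm0⟩ := (mem_nullSet_unitPairs hx).1 (hΩ1.superset hx)
  suffices ∃ f : Fin 4 → ℝ, f ⬝ᵥ f = 1 ∧ m ⬝ᵥ f = 0 ∧ d2 v x f f ≤ d2 v x n n + d2 v x e e by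
    obtain ⟨f, hf, hmf, hle⟩ := this
    exact ⟨m, f, ⟨⟨hm, hf⟩, hmf⟩, by simpa [pairVal, hm0] using hle, hm0, Or.inr hm, hf, hmf,
      fun w hw hwm => ⟨⟨hm, hw⟩, (dotProduct_comm m w).trans hwm⟩⟩
  by_cases hc : m ⬝ᵥ e = 0
  · exact ⟨e, he, hc, le_add_of_nonneg_left (hpos x hx n)⟩
  · set a := m ⬝ᵥ n
    set b := m ⬝ᵥ e
    have hen : e ⬝ᵥ n = 0 := (dotProduct_comm e n).trans hne
    have huu : (b • n - a • e) ⬝ᵥ (b • n - a • e) = a ^ 2 + b ^ 2 := by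
      simp only [sub_dotProduct, dotProduct_sub, smul_dotProduct, dotProduct_smul, smul_eq_mul,
        hn, he, hne, hen]
      ring
    have hu : b • n - a • e ≠ 0 := fun h => by
      rw [h, zero_dotProduct] at huu
      have := pow_pos (abs_pos.2 hc) 2
      rw [sq_abs] at this
      linarith [sq_nonneg a]
    obtain ⟨c, hc1, hc2⟩ := exists_unit_smul hu
    refine ⟨c • (b • n - a • e), hc1, ?_, ?_⟩
    · rw [dotProduct_smul, dotProduct_sub, dotProduct_smul, dotProduct_smul, smul_eq_mul,
        smul_eq_mul, smul_eq_mul]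
      ring
    · rw [huu] at hc2
      have h1 : 0 ≤ c ^ 2 * d2 v x (a • n + b • e) (a • n + b • e) :=
        mul_nonneg (sq_nonneg c) (hpos x hx _)
      have h2 : d2 v x (c • (b • n - a • e)) (c • (b • n - a • e)) +
          c ^ 2 * d2 v x (a • n + b • e) (a • n + b • e) = d2 v x n n + d2 v x e e := by
        simp only [map_smul, map_add, map_sub, smul_apply, add_apply, sub_apply, smul_eq_mul]
        linear_combination (d2 v x n n + d2 v x e e) * hc2
      linarith

theorem d2_eq_hessM_mulVec (hv : ContDiffAt ℝ 4 v x) (y z : Fin 4 → ℝ) :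
    d2 v x y z = y ⬝ᵥ (hessM v x).mulVec z := by
  rw [bilin_expand]
  simp only [dotProduct, Matrix.mulVec, Finset.mul_sum, hessM, Matrix.of_apply, pd2_eq_d2 hv]
  exact Finset.sum_congr rfl fun i _ => Finset.sum_congr rfl fun j _ => by ring

theorem mem_ker_hessM (hΩ : IsOpen Ω) (hstar : StarEq lam v Ω) (hlam : 0 < lam) (hx : x ∈ Ω)
    (hv : ∀ z ∈ Ω, ContDiffAt ℝ 4 v z) (hpos : ∀ z ∈ Ω, ∀ y, 0 ≤ d2 v z y y) {w : Fin 4 → ℝ} :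
    w ∈ LinearMap.ker (hessM v x).mulVecLin ↔ d2 v x w w = 0 := by
  rw [LinearMap.mem_ker, Matrix.mulVecLin_apply]
  refine ⟨fun h => by rw [d2_eq_hessM_mulVec (hv x hx), h, dotProduct_zero], fun h => ?_⟩
  refine dotProduct_self_eq_zero.1 ?_
  rw [← d2_eq_hessM_mulVec (hv x hx), d2_symm (hv x hx)]
  exact (null_direction hΩ hstar hlam hx (hv x hx) hpos h).1 _

/-- The complex structure as a linear map. -/
def cplxLin : (Fin 4 → ℝ) →ₗ[ℝ] Fin 4 → ℝ where
  toFun := cplx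
  map_add' y z := by
    ext i
    fin_cases i <;> simp [cplx] <;> ring
  map_smul' c y := by
    ext i
    fin_cases i <;> simp [cplx]

theorem cplx_cplx (y : Fin 4 → ℝ) : cplx (cplx y) = -y := by
  ext i
  fin_cases i <;> simp [cplx]

theorem hermVec_hermCof_hermVec (a y : Fin 4 → ℝ) :
    hermVec (hermCof a) (hermVec a y) = hermDet a • y := by
  ext i
  fin_cases i <;> simp [hermVec, hermCof, hermDet] <;> ring

theorem finrank_ker_hessM_le (hstar : StarEq lam v Ω) (hlam : 0 < lam) (hx : x ∈ Ω)
    (hv : ContDiffAt ℝ 4 v x) (hpos : ∀ y, 0 ≤ d2 v x y y) :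
    Module.finrank ℝ (LinearMap.ker (hessM v x).mulVecLin) ≤ 2 := by
  set K := LinearMap.ker (hessM v x).mulVecLin
  have hinj : Function.Injective cplxLin := fun y z h => by
    have := congrArg cplx (show cplx y = cplx z from h)
    rwa [cplx_cplx, cplx_cplx, neg_inj] at this
  have hdim : Module.finrank ℝ (K.map cplxLin) = Module.finrank ℝ K :=
    (Submodule.equivMapOfInjective cplxLin hinj K).finrank_eq.symm
  have hbot : K ⊓ K.map cplxLin = ⊥ := by
    rw [Submodule.eq_bot_iff]
    rintro _ ⟨h1, y, h2, rfl⟩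
    have h1' : (hessM v x).mulVec (cplx y) = 0 := h1
    have h2' : (hessM v x).mulVec y = 0 := h2
    have hS := fun y z => d2_symm hv y z
    have hdet := hermDet_starForm hstar hx hv
    have hge := (hermDet_hermPart_ge hS hpos _ hlam hdet).1
    have hz : hermVec (hermPart (d2 v x)) y = 0 := by
      refine dotProduct_self_eq_zero.1 ?_
      rw [← apply_add_apply_cplx hS, hS, hS (cplx y), d2_eq_hessM_mulVec hv,
        d2_eq_hessM_mulVec hv, h1', h2', dotProduct_zero, dotProduct_zero, add_zero]
    have hy := hermVec_hermCof_hermVec (hermPart (d2 v x)) y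
    have h0 : ∀ m, hermVec m 0 = 0 := fun m => by
      ext i
      fin_cases i <;> simp [hermVec]
    rw [hz, h0] at hy
    rw [(smul_eq_zero.1 hy.symm).resolve_left (hlam.trans_le hge).ne', map_zero]
  have h := Submodule.finrank_sup_add_finrank_inf_eq K (K.map cplxLin)
  have h' := Submodule.finrank_le (K ⊔ K.map cplxLin)
  rw [hbot, finrank_bot, hdim] at h
  rw [Module.finrank_fin_fun] at h'
  omega

theorem one_le_finrank_ker_hessM (hΩ : IsOpen Ω) (hstar : StarEq lam v Ω) (hlam : 0 < lam)
    (hx : x ∈ Ω) (hv : ∀ z ∈ Ω, ContDiffAt ℝ 4 v z) (hpos : ∀ z ∈ Ω, ∀ y, 0 ≤ d2 v z y y) :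
    1 ≤ Module.finrank ℝ (LinearMap.ker (hessM v x).mulVecLin) ↔ x ∈ nullSet v Ω unitPairs := by
  rw [Submodule.one_le_finrank_iff, Submodule.ne_bot_iff, mem_nullSet_unitPairs hx]
  constructor
  · rintro ⟨u, hu, hu0⟩
    obtain ⟨c, hc, -⟩ := exists_unit_smul hu0
    exact ⟨c • u, hc,
      (mem_ker_hessM hΩ hstar hlam hx hv hpos).1 (Submodule.smul_mem _ c hu)⟩
  · rintro ⟨e, he, he0⟩
    refine ⟨e, (mem_ker_hessM hΩ hstar hlam hx hv hpos).2 he0, ?_⟩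
    rintro rfl
    simp at he

theorem two_le_finrank_ker_hessM (hΩ : IsOpen Ω) (hstar : StarEq lam v Ω) (hlam : 0 < lam)
    (hx : x ∈ Ω) (hv : ∀ z ∈ Ω, ContDiffAt ℝ 4 v z) (hpos : ∀ z ∈ Ω, ∀ y, 0 ≤ d2 v z y y) :
    2 ≤ Module.finrank ℝ (LinearMap.ker (hessM v x).mulVecLin) ↔
      x ∈ nullSet v Ω orthonormalPairs := by
  rw [mem_nullSet_orthonormalPairs hx hpos]
  constructor
  · intro h
    obtain ⟨n, hn, hn0⟩ := (mem_nullSet_unitPairs hx).1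
      ((one_le_finrank_ker_hessM hΩ hstar hlam hx hv hpos).1 (one_le_two.trans h))
    set K := LinearMap.ker (hessM v x).mulVecLin
    have hker := LinearMap.ker_ne_bot_of_finrank_lt
      (f := (dotProductBilin ℝ ℝ n).comp K.subtype) (by rw [Module.finrank_self]; omega)
    obtain ⟨⟨u, hu⟩, hnu, hu0⟩ := (Submodule.ne_bot_iff _).1 hker
    have hu0' : u ≠ 0 := fun h => hu0 (Subtype.ext h)
    have hnu' : n ⬝ᵥ u = 0 := hnu
    obtain ⟨c, hc, -⟩ := exists_unit_smul hu0'
    exact ⟨n, c • u, hn, hc, by rw [dotProduct_smul, hnu', smul_zero], hn0,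
      (mem_ker_hessM hΩ hstar hlam hx hv hpos).1 (Submodule.smul_mem _ c hu)⟩
  · rintro ⟨n, e, hn, he, hne, hn0, he0⟩
    by_contra! h
    obtain ⟨⟨u, hu⟩, hspan⟩ := finrank_le_one_iff.1 (Nat.le_of_lt_succ h)
    obtain ⟨a, ha⟩ := hspan ⟨n, (mem_ker_hessM hΩ hstar hlam hx hv hpos).2 hn0⟩
    obtain ⟨b, hb⟩ := hspan ⟨e, (mem_ker_hessM hΩ hstar hlam hx hv hpos).2 he0⟩
    have ha' : a • u = n := congrArg Subtype.val ha
    have hb' : b • u = e := congrArg Subtype.val hb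
    rw [← ha', smul_dotProduct, dotProduct_smul, smul_eq_mul, smul_eq_mul] at hn
    rw [← hb', smul_dotProduct, dotProduct_smul, smul_eq_mul, smul_eq_mul] at he
    rw [← ha', ← hb', smul_dotProduct, dotProduct_smul, smul_eq_mul, smul_eq_mul] at hne
    have : (a * (a * (u ⬝ᵥ u))) * (b * (b * (u ⬝ᵥ u))) = (a * (b * (u ⬝ᵥ u))) ^ 2 := by ring
    rw [hn, he, hne] at this
    norm_num at this

end Rank

/-- constant rank theorem: the Hessian of a convex `C⁴` solution of
equation (★) on a connected open set `Ω ⊂ ℝ⁴` has the same rank at all points. -/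
theorem constant_rank_theorem
    (Ω : Set (Fin 4 → ℝ)) (hΩ : IsOpen Ω) (hconn : IsConnected Ω)
    (lam : ℝ) (hlam : 0 < lam)
    (v : (Fin 4 → ℝ) → ℝ) (hv : ContDiffOn ℝ 4 v Ω)
    (hconv : ConvexOn ℝ Ω v)
    (hstar : StarEq lam v Ω) :
    ∀ x ∈ Ω, ∀ y ∈ Ω, (hessM v x).rank = (hessM v y).rank := by
  have hva : ∀ z ∈ Ω, ContDiffAt ℝ 4 v z := fun z hz => hv.contDiffAt (hΩ.mem_nhds hz)
  have hpos : ∀ z ∈ Ω, ∀ y, 0 ≤ d2 v z y y := fun z hz y =>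
    d2_nonneg_of_convexOn hΩ hconv hz (hva z hz) y
  have hZ1 : (nullSet v Ω unitPairs).Nonempty → nullSet v Ω unitPairs = Ω :=
    nullSet_eq_of_nonempty hΩ hconn hstar hlam hva hpos isCompact_unitPairs reducible_unitPairs
  have hZ2 : (nullSet v Ω orthonormalPairs).Nonempty → nullSet v Ω orthonormalPairs = Ω := by
    rintro ⟨x, hx⟩
    have h2 := (two_le_finrank_ker_hessM hΩ hstar hlam hx.1 hva hpos).2 hx
    have h1 := hZ1 ⟨x, (one_le_finrank_ker_hessM hΩ hstar hlam hx.1 hva hpos).1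
      (one_le_two.trans h2)⟩
    exact nullSet_eq_of_nonempty hΩ hconn hstar hlam hva hpos isCompact_orthonormalPairs
      (reducible_orthonormalPairs hpos h1) ⟨x, hx⟩
  have hrank : ∀ z, (hessM v z).rank +
      Module.finrank ℝ (LinearMap.ker (hessM v z).mulVecLin) = 4 := fun z => by
    have := LinearMap.finrank_range_add_finrank_ker (hessM v z).mulVecLin
    rwa [Module.finrank_fin_fun] at this
  have hmono : ∀ x ∈ Ω, ∀ y ∈ Ω, Module.finrank ℝ (LinearMap.ker (hessM v x).mulVecLin) ≤
      Module.finrank ℝ (LinearMap.ker (hessM v y).mulVecLin) := fun x hx y hy => by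
    have hle := finrank_ker_hessM_le hstar hlam hx (hva x hx) (hpos x hx)
    have h1 : 1 ≤ Module.finrank ℝ (LinearMap.ker (hessM v x).mulVecLin) →
        1 ≤ Module.finrank ℝ (LinearMap.ker (hessM v y).mulVecLin) := fun h => by
      rw [one_le_finrank_ker_hessM hΩ hstar hlam hy hva hpos, hZ1 ⟨x,
        (one_le_finrank_ker_hessM hΩ hstar hlam hx hva hpos).1 h⟩]
      exact hy
    have h2 : 2 ≤ Module.finrank ℝ (LinearMap.ker (hessM v x).mulVecLin) →
        2 ≤ Module.finrank ℝ (LinearMap.ker (hessM v y).mulVecLin) := fun h => by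
      rw [two_le_finrank_ker_hessM hΩ hstar hlam hy hva hpos, hZ2 ⟨x,
        (two_le_finrank_ker_hessM hΩ hstar hlam hx hva hpos).1 h⟩]
      exact hy
    omega
  intro x hx y hy
  have := hmono x hx y hy
  have := hmono y hy x hx
  have := hrank x
  have := hrank y
  omega
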